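/- arXiv:1703.02841 — 2 statements merged into one kernel-verified Lean document; each statement's English description precedes it below -/
import Mathlib

section
/- Let 1 ≤ p < ∞, let 0 ≤ β < 1/2, and let E ⊆ 𝕋 be a closed set. There exists a sequence (f_n) of Lipschitz functions on 𝕋 which vanish on E and satisfy ‖f_n − 1‖_{A^p_β(𝕋)} → 0 if and only if every f ∈ A^1_β(𝕋) satisfying Z(f) = E is cyclic in A^p_β(𝕋). -/
open MeasureTheory Real Set Filter Topology ENNReal

noncomputable section

instance : Fact (0 < 2 * Real.pi) := ⟨by positivity⟩

/-- The weighted sum `∑ ‖c n‖^p (1+|n|)^{pβ}` of a Fourier-coefficient sequence,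
i.e. `‖c‖_{ℓ^p_β}^p`. -/
def wSum (p β : ℝ) (c : ℤ → ℂ) : ℝ :=
  ∑' n : ℤ, ‖c n‖ ^ p * (1 + |(n : ℝ)|) ^ (p * β)

/-- Membership in `A^p_β(𝕋)` (equivalently `ℓ^p_β(ℤ)`), expressed via the
Fourier coefficient sequence `c`. -/
def MemA (p β : ℝ) (c : ℤ → ℂ) : Prop :=
  Summable fun n : ℤ => ‖c n‖ ^ p * (1 + |(n : ℝ)|) ^ (p * β)

/-- The `A^p_β(𝕋)` (i.e. `ℓ^p_β(ℤ)`) norm of a Fourier-coefficient sequence. -/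
def normA (p β : ℝ) (c : ℤ → ℂ) : ℝ := (wSum p β c) ^ (1 / p)

/-- The function on the circle `𝕋 = ℝ/2πℤ` whose Fourier coefficient sequence is `c`,
namely `t ↦ ∑_{n ∈ ℤ} c_n e^{int}`. -/
def fSum (c : ℤ → ℂ) (t : AddCircle (2 * Real.pi)) : ℂ :=
  ∑' n : ℤ, c n * fourier n t

/-- The zero set `Z(f)` of the function `f` with Fourier coefficients `c`. -/
def zeroSet (c : ℤ → ℂ) : Set (AddCircle (2 * Real.pi)) := {t | fSum c t = 0}

/-- Convolution of coefficient sequences: the Fourier coefficients of the product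
of the corresponding functions/distributions. -/
def convSeq (a c : ℤ → ℂ) (n : ℤ) : ℂ := ∑' k : ℤ, a k * c (n - k)

/-- Cyclicity of (the element with coefficients) `c` in `A^p_β(𝕋)`: there are
trigonometric polynomials `P` (finitely supported coefficient sequences `a`) with
`‖1 - P·f‖_{A^p_β}` arbitrarily small. -/
def IsCyclicA (p β : ℝ) (c : ℤ → ℂ) : Prop :=
  ∀ ε : ℝ, 0 < ε → ∃ a : ℤ → ℂ, (Function.support a).Finite ∧
    normA p β (fun n => (if n = 0 then 1 else 0) - convSeq a c n) < ε

/-- Fourier coefficient `μ̂(n) = ∫ e^{-int} dμ(t)` of a measure on `ℝ/2πℤ`. -/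
def muHat (μ : Measure (AddCircle (2 * Real.pi))) (n : ℤ) : ℂ :=
  ∫ t, fourier (-n) t ∂μ

/-- The `α`-energy `I_α(μ) = ∑_{n ≥ 1} |μ̂(n)|²/(1+n)^{1-α}` of `μ` is finite. -/
def HasFiniteEnergy (α : ℝ) (μ : Measure (AddCircle (2 * Real.pi))) : Prop :=
  Summable fun n : ℕ => ‖muHat μ (n + 1)‖ ^ 2 / (1 + ((n : ℝ) + 1)) ^ (1 - α)

/-- `C_α(E) = 0`: every probability measure supported on a compact subset of `E`
has infinite `α`-energy. -/
def CapacityZero (α : ℝ) (E : Set (AddCircle (2 * Real.pi))) : Prop :=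
  ∀ μ : Measure (AddCircle (2 * Real.pi)), IsProbabilityMeasure μ →
    (∃ K, K ⊆ E ∧ IsCompact K ∧ μ Kᶜ = 0) → ¬ HasFiniteEnergy α μ

/-- `C_α(E) > 0`: some probability measure supported on a compact subset of `E`
has finite `α`-energy. -/
def CapacityPos (α : ℝ) (E : Set (AddCircle (2 * Real.pi))) : Prop :=
  ∃ μ : Measure (AddCircle (2 * Real.pi)), IsProbabilityMeasure μ ∧
    (∃ K, K ⊆ E ∧ IsCompact K ∧ μ Kᶜ = 0) ∧ HasFiniteEnergy α μ

/-- The `k`-fold Minkowski sum `k × E = E + ⋯ + E`. -/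
def kFold (k : ℕ) (E : Set (AddCircle (2 * Real.pi))) : Set (AddCircle (2 * Real.pi)) :=
  {x | ∃ g : Fin k → AddCircle (2 * Real.pi), (∀ i, g i ∈ E) ∧ x = ∑ i, g i}

/-- Smoothness (`C^∞`) of a function on the circle, via its lift to `ℝ`. -/
def SmoothOnCircle (φ : AddCircle (2 * Real.pi) → ℂ) : Prop :=
  ContDiff ℝ (⊤ : ℕ∞) fun x : ℝ => φ (↑x)

/-- `supp S ⊆ E` for the distribution `S` with Fourier coefficients `s`:
`⟨S, φ⟩ = ∑ₙ Ŝ(n) φ̂(−n) = 0` for every `C^∞` function `φ` supported in `𝕋 ∖ E`. -/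
def DistSuppIn (s : ℤ → ℂ) (E : Set (AddCircle (2 * Real.pi))) : Prop :=
  ∀ φ : AddCircle (2 * Real.pi) → ℂ, SmoothOnCircle φ → tsupport φ ⊆ Eᶜ →
    ∑' n : ℤ, s n * fourierCoeff φ (-n) = 0

abbrev TT := AddCircle (2 * Real.pi)

lemma cint (u : C(TT, ℂ)) : Integrable (u : TT → ℂ) AddCircle.haarAddCircle :=
  u.continuous.integrable_of_hasCompactSupport (HasCompactSupport.of_compactSpace _)

lemma norm_fourier' (n : ℤ) (t : TT) : ‖(fourier n t : ℂ)‖ = 1 := by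
  rw [fourier_apply]; exact Circle.norm_coe _

lemma fc_norm_le (u : TT → ℂ) (M : ℝ) (h : ∀ t, ‖u t‖ ≤ M) (n : ℤ) :
    ‖fourierCoeff u n‖ ≤ M := by
  unfold fourierCoeff
  have := norm_integral_le_of_norm_le_const (μ := (AddCircle.haarAddCircle : Measure TT))
    (f := fun t => fourier (-n) t • u t) (C := M) (Eventually.of_forall fun t => by
      rw [norm_smul, norm_fourier', one_mul]; exact h t)
  simpa using this

/-- Fourier coefficient as a continuous linear functional. -/
def coeffL (n : ℤ) : C(TT, ℂ) →L[ℂ] ℂ :=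
  LinearMap.mkContinuous
    { toFun := fun u => fourierCoeff u n
      map_add' := fun u v => by
        rw [ContinuousMap.coe_add, fourierCoeff.add (cint u) (cint v)]; rfl
      map_smul' := fun c u => by
        rw [ContinuousMap.coe_smul, fourierCoeff.const_smul]; rfl } 1
    (fun u => by
      rw [one_mul]
      exact fc_norm_le u _ (fun t => u.norm_coe_le_norm t) n)

lemma coeffL_apply (n : ℤ) (u : C(TT, ℂ)) : coeffL n u = fourierCoeff u n := rfl

lemma fc_add (u v : C(TT, ℂ)) (n : ℤ) :
    fourierCoeff (u + v : C(TT, ℂ)) n = fourierCoeff u n + fourierCoeff v n :=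
  (coeffL n).map_add u v

lemma fc_sub (u v : C(TT, ℂ)) (n : ℤ) :
    fourierCoeff (u - v : C(TT, ℂ)) n = fourierCoeff u n - fourierCoeff v n :=
  (coeffL n).map_sub u v

lemma fc_fourier (k n : ℤ) :
    fourierCoeff (fourier k : C(TT, ℂ)) n = if n = k then 1 else 0 := by
  rw [fourierCoeff_fourier]; simp [Pi.single_apply]

lemma fc_fourier_mul (k n : ℤ) (g : C(TT, ℂ)) :
    fourierCoeff ((fourier k : C(TT, ℂ)) * g : C(TT, ℂ)) n = fourierCoeff g (n - k) := by
  unfold fourierCoeff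
  congr 1
  ext t
  have : (-(n - k) : ℤ) = -n + k := by ring
  rw [this, fourier_add]
  simp [-fourier_apply, mul_assoc]

/-- Fourier coefficients of a product. -/
lemma fc_mul (f g : C(TT, ℂ)) (hf : Summable (fourierCoeff f)) (n : ℤ) :
    fourierCoeff (f * g : C(TT, ℂ)) n = convSeq (fourierCoeff f) (fourierCoeff g) n := by
  have h := hasSum_fourier_series_of_summable hf
  have h2 := h.mul_right g
  have h3 := (coeffL n).hasSum h2
  unfold convSeq
  rw [← coeffL_apply, ← h3.tsum_eq]
  congr 1
  ext k
  rw [smul_mul_assoc, map_smul, coeffL_apply, fc_fourier_mul, smul_eq_mul]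

/-- The weighted `ℓ¹` norm, as an extended nonnegative real. -/
def WW (β : ℝ) (c : ℤ → ℂ) : ℝ≥0∞ :=
  ∑' n : ℤ, ‖c n‖ₑ * ENNReal.ofReal ((1 + |(n : ℝ)|) ^ β)

/-- The norm of the function `u` in `A^1_β`. -/
def AA (β : ℝ) (u : C(TT, ℂ)) : ℝ≥0∞ := WW β (fourierCoeff u)

lemma one_le_w {β : ℝ} (hβ : 0 ≤ β) (n : ℤ) : 1 ≤ (1 + |(n : ℝ)|) ^ β :=
  Real.one_le_rpow (by linarith [abs_nonneg (n : ℝ)]) hβ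

lemma WW_add (β : ℝ) (a b : ℤ → ℂ) : WW β (fun n => a n + b n) ≤ WW β a + WW β b := by
  unfold WW
  rw [← ENNReal.tsum_add]
  refine ENNReal.tsum_le_tsum fun n => ?_
  rw [← add_mul]
  gcongr
  exact enorm_add_le _ _

lemma AA_add (β : ℝ) (u v : C(TT, ℂ)) : AA β (u + v) ≤ AA β u + AA β v := by
  refine le_trans (le_of_eq ?_) (WW_add β _ _)
  unfold AA
  congr 1
  ext n
  exact fc_add u v n

lemma AA_sub_comm (β : ℝ) (u v : C(TT, ℂ)) : AA β (u - v) = AA β (v - u) := by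
  unfold AA WW
  congr 1
  ext n
  rw [fc_sub, fc_sub, enorm_sub_rev]

lemma AA_zero (β : ℝ) : AA β 0 = 0 := by
  unfold AA WW
  have : ∀ n, fourierCoeff ((0 : C(TT, ℂ)) : TT → ℂ) n = 0 := fun n => (coeffL n).map_zero
  simp only [this]
  simp

lemma AA_sub (β : ℝ) (u v : C(TT, ℂ)) : AA β (u - v) ≤ AA β u + AA β v := by
  have h := AA_add β u (0 - v)
  rw [AA_sub_comm β 0 v] at h
  simpa [sub_eq_add_neg] using h

lemma WW_conv {β : ℝ} (hβ : 0 ≤ β) (a c : ℤ → ℂ) :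
    WW β (convSeq a c) ≤ WW β a * WW β c := by
  set w : ℤ → ℝ≥0∞ := fun n => ENNReal.ofReal ((1 + |(n : ℝ)|) ^ β) with hw
  have hsub : ∀ n k : ℤ, w n ≤ w k * w (n - k) := by
    intro n k
    rw [hw]
    simp only
    rw [← ENNReal.ofReal_mul (by positivity)]
    apply ENNReal.ofReal_le_ofReal
    rw [← Real.mul_rpow (by positivity) (by positivity)]
    apply Real.rpow_le_rpow (by positivity) _ hβ
    have h1 : |(n : ℝ)| ≤ |(k : ℝ)| + |((n - k : ℤ) : ℝ)| := by
      have := abs_add_le (k : ℝ) ((n - k : ℤ) : ℝ)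
      simpa using this
    nlinarith [mul_nonneg (abs_nonneg (k : ℝ)) (abs_nonneg ((n - k : ℤ) : ℝ))]
  calc WW β (convSeq a c) ≤ ∑' n, (∑' k, ‖a k‖ₑ * ‖c (n - k)‖ₑ) * w n := by
        refine ENNReal.tsum_le_tsum fun n => ?_
        gcongr
        refine enorm_tsum_le_tsum_enorm.trans (le_of_eq ?_)
        simp [enorm_mul]
    _ ≤ ∑' n, ∑' k, (‖a k‖ₑ * w k) * (‖c (n - k)‖ₑ * w (n - k)) := by
        refine ENNReal.tsum_le_tsum fun n => ?_
        rw [← ENNReal.tsum_mul_right]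
        refine ENNReal.tsum_le_tsum fun k => ?_
        calc _ ≤ ‖a k‖ₑ * ‖c (n - k)‖ₑ * (w k * w (n - k)) := by gcongr; exact hsub n k
          _ = _ := by ring
    _ = ∑' k, ∑' n, (‖a k‖ₑ * w k) * (‖c (n - k)‖ₑ * w (n - k)) := ENNReal.tsum_comm
    _ = ∑' k, (‖a k‖ₑ * w k) * WW β c := by
        congr 1
        ext k
        rw [ENNReal.tsum_mul_left]
        congr 1
        exact (Equiv.subRight k).tsum_eq (fun m => ‖c m‖ₑ * w m)
    _ = _ := by rw [ENNReal.tsum_mul_right]; rfl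

lemma tsum_enorm_le_WW {β : ℝ} (hβ : 0 ≤ β) (c : ℤ → ℂ) : ∑' n, ‖c n‖ₑ ≤ WW β c := by
  refine ENNReal.tsum_le_tsum fun n => ?_
  calc ‖c n‖ₑ = ‖c n‖ₑ * 1 := (mul_one _).symm
    _ ≤ _ := by
      gcongr
      rw [← ENNReal.ofReal_one]
      exact ENNReal.ofReal_le_ofReal (one_le_w hβ n)

lemma summable_of_WW {β : ℝ} (hβ : 0 ≤ β) (c : ℤ → ℂ) (h : WW β c < ⊤) : Summable c := by
  have h1 : ∑' n, ‖c n‖ₑ ≠ ⊤ := ((tsum_enorm_le_WW hβ c).trans_lt h).ne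
  have := ENNReal.summable_toReal h1
  exact Summable.of_norm (by simpa using this)

lemma AA_mul {β : ℝ} (hβ : 0 ≤ β) (f g : C(TT, ℂ)) (hf : AA β f < ⊤) :
    AA β (f * g) ≤ AA β f * AA β g := by
  refine le_trans (le_of_eq ?_) (WW_conv hβ _ _)
  unfold AA
  congr 1
  ext n
  exact fc_mul f g (summable_of_WW hβ _ hf) n

lemma AA_one (β : ℝ) : AA β 1 = 1 := by
  have h1 : (1 : C(TT, ℂ)) = fourier 0 := by ext t; simp
  unfold AA WW
  rw [h1]
  simp only [fc_fourier]
  rw [tsum_eq_single 0]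
  · simp
  · intro n hn; simp [hn]

lemma AA_pow {β : ℝ} (hβ : 0 ≤ β) (f : C(TT, ℂ)) (hf : AA β f < ⊤) (N : ℕ) :
    AA β (f ^ N) ≤ AA β f ^ N := by
  induction N with
  | zero => simp [AA_one]
  | succ k ih =>
    rw [pow_succ', pow_succ']
    refine (AA_mul hβ _ _ hf).trans ?_
    gcongr

lemma sup_le_AA {β : ℝ} (hβ : 0 ≤ β) (f : C(TT, ℂ)) (hf : AA β f < ⊤) (t : TT) :
    ‖f t‖ₑ ≤ AA β f := by
  have hs := summable_of_WW hβ _ hf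
  rw [← (has_pointwise_sum_fourier_series_of_summable hs t).tsum_eq]
  refine enorm_tsum_le_tsum_enorm.trans (le_trans (le_of_eq ?_) (tsum_enorm_le_WW hβ _))
  congr 1
  ext n
  rw [enorm_smul]
  have : ‖(fourier n t : ℂ)‖ₑ = 1 := by
    rw [← ofReal_norm, norm_fourier']; simp
  rw [this, mul_one]

/-- Trigonometric polynomial. -/
def trigP (S : Finset ℤ) (a : ℤ → ℂ) : C(TT, ℂ) := ∑ k ∈ S, a k • fourier k

lemma fc_trigP (S : Finset ℤ) (a : ℤ → ℂ) (n : ℤ) :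
    fourierCoeff (trigP S a) n = if n ∈ S then a n else 0 := by
  rw [← coeffL_apply, trigP, map_sum]
  simp only [map_smul, coeffL_apply, fc_fourier]
  simp

lemma AA_trig {β : ℝ} (f : C(TT, ℂ)) (hf : AA β f < ⊤) (ε : ℝ≥0∞) (hε : 0 < ε) :
    ∃ S : Finset ℤ, AA β (f - trigP S (fourierCoeff f)) < ε := by
  set F : ℤ → ℝ≥0∞ := fun n => ‖fourierCoeff f n‖ₑ * ENNReal.ofReal ((1 + |(n : ℝ)|) ^ β)
  have ht := ENNReal.tendsto_tsum_compl_atTop_zero (f := F) hf.ne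
  obtain ⟨S, hS⟩ := (ht.eventually (gt_mem_nhds hε)).exists
  refine ⟨S, lt_of_le_of_lt (le_of_eq ?_) hS⟩
  unfold AA WW
  rw [← tsum_subtype_eq_of_support_subset (s := {x | x ∉ S})]
  · refine tsum_congr fun n => ?_
    have := n.2
    rw [Set.mem_ofPred_eq] at this
    rw [fc_sub, fc_trigP, if_neg this, sub_zero]
  · intro n hn
    simp only [Function.mem_support, ne_eq] at hn
    intro hnS
    apply hn
    rw [fc_sub, fc_trigP, if_pos hnS]; simp

lemma exists_lift (z : TT) : ∃ r : ℝ, (r : TT) = z ∧ |r| = ‖z‖ := by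
  induction z using QuotientAddGroup.induction_on with
  | H x =>
    refine ⟨x - round ((2 * Real.pi)⁻¹ * x) * (2 * Real.pi), ?_, (AddCircle.norm_eq (2 * Real.pi)).symm⟩
    rw [AddCircle.coe_sub]
    have : ((round ((2 * Real.pi)⁻¹ * x) * (2 * Real.pi) : ℝ) : TT) = 0 := by
      rw [AddCircle.coe_eq_zero_iff]
      exact ⟨round ((2 * Real.pi)⁻¹ * x), by simp⟩
    rw [this, sub_zero]

lemma fourier_real (n : ℤ) (r : ℝ) :
    (fourier n (r : TT) : ℂ) = Complex.exp (Complex.I * ((n * r : ℝ) : ℂ)) := by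
  rw [fourier_coe_apply]
  congr 1
  have : (Real.pi : ℂ) ≠ 0 := by exact_mod_cast Real.pi_ne_zero
  push_cast
  field_simp

lemma fourier_add_arg (n : ℤ) (x y : TT) :
    (fourier n (x + y) : ℂ) = fourier n x * fourier n y := by
  simp only [fourier_apply, smul_add, AddCircle.toCircle_add, Circle.coe_mul]

/-- Lipschitz with a real constant. -/
def LipR (L : ℝ) (u : TT → ℂ) : Prop := ∀ x y, ‖u x - u y‖ ≤ L * dist x y

lemma LipR.mk' {L : ℝ} {u : TT → ℂ} (h : LipR L u) : ∃ K : NNReal, LipschitzWith K u := by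
  refine ⟨L.toNNReal, LipschitzWith.of_dist_le_mul fun x y => ?_⟩
  rw [dist_eq_norm]
  refine (h x y).trans ?_
  gcongr
  exact Real.le_coe_toNNReal L

lemma LipR.of {K : NNReal} {u : TT → ℂ} (h : LipschitzWith K u) : LipR K u := fun x y => by
  rw [← dist_eq_norm]; exact h.dist_le_mul x y

lemma fourier_lip (n : ℤ) : LipR |(n : ℝ)| (fourier n : C(TT, ℂ)) := by
  intro x y
  obtain ⟨r, hr, hr2⟩ := exists_lift (x - y)
  have h1 : (fourier n x : ℂ) = fourier n (x - y) * fourier n y := by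
    rw [← fourier_add_arg, sub_add_cancel]
  have h2 : (fourier n x : ℂ) - fourier n y = (fourier n (x - y) - 1) * fourier n y := by
    rw [h1]; ring
  rw [h2, norm_mul, norm_fourier', mul_one, ← hr, fourier_real, dist_eq_norm, ← hr2, ← abs_mul]
  exact norm_exp_I_mul_ofReal_sub_one_le

lemma fc_translate (u : C(TT, ℂ)) (h : TT) (n : ℤ) :
    fourierCoeff (fun t => u (t + h)) n = fourier n h * fourierCoeff u n := by
  unfold fourierCoeff
  have := integral_add_right_eq_self (μ := (AddCircle.haarAddCircle : Measure TT))
    (fun t => (fourier (-n) (t - h) : ℂ) • u t) h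
  simp only [add_sub_cancel_right] at this
  rw [this, ← integral_const_mul]
  congr 1
  ext t
  have h1 : (fourier (-n) (t - h) : ℂ) = fourier (-n) t * fourier n h := by
    rw [sub_eq_add_neg, fourier_add_arg]
    congr 1
    simp [fourier_apply]
  rw [h1, smul_eq_mul, smul_eq_mul]; ring

lemma bessel (u : C(TT, ℂ)) (M : ℝ) (h : ∀ t, ‖u t‖ ≤ M) (F : Finset ℤ) :
    ∑ n ∈ F, ‖fourierCoeff u n‖ ^ 2 ≤ M ^ 2 := by
  have hs := hasSum_sq_fourierCoeff (ContinuousMap.toLp (E := ℂ) 2 AddCircle.haarAddCircle ℂ u)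
  simp only [fourierCoeff_toLp] at hs
  refine (sum_le_hasSum F (fun _ _ => by positivity) hs).trans ?_
  have h1 : ∫ t : TT, ‖(ContinuousMap.toLp (E := ℂ) 2 AddCircle.haarAddCircle ℂ u) t‖ ^ 2
      ∂AddCircle.haarAddCircle = ∫ t : TT, ‖u t‖ ^ 2 ∂AddCircle.haarAddCircle := by
    apply integral_congr_ae
    filter_upwards [ContinuousMap.coeFn_toLp (p := 2) (𝕜 := ℂ) AddCircle.haarAddCircle u] with t ht
    rw [ht]
  rw [h1]
  have h2 := norm_integral_le_of_norm_le_const (μ := (AddCircle.haarAddCircle : Measure TT))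
    (f := fun t => ‖u t‖ ^ 2) (C := M ^ 2) (Eventually.of_forall fun t => by
      have := h t
      have h0 := norm_nonneg (u t)
      rw [Real.norm_of_nonneg (by positivity)]
      gcongr)
  refine (le_abs_self _).trans ?_
  simpa using h2

lemma bernstein_sq (u : C(TT, ℂ)) (K : ℝ) (hK : 0 ≤ K) (hu : LipR K u) (F : Finset ℤ) :
    ∑ n ∈ F, ((n : ℝ) * ‖fourierCoeff u n‖) ^ 2 ≤ (Real.pi / 2 * K) ^ 2 := by
  have hpi := Real.pi_pos
  obtain ⟨N, hN1, hN⟩ : ∃ N : ℝ, 0 < N ∧ ∀ n ∈ F, |(n : ℝ)| ≤ N := by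
    refine ⟨1 + ∑ n ∈ F, |(n : ℝ)|, by positivity, fun n hn => ?_⟩
    have := Finset.single_le_sum (f := fun n : ℤ => |(n : ℝ)|) (fun i _ => abs_nonneg _) hn
    linarith
  set h : ℝ := Real.pi / N with hh
  have hpos : 0 < h := by positivity
  set v : C(TT, ℂ) := ⟨fun t => u (t + (h : TT)), by fun_prop⟩ - u with hv
  have hv1 : ∀ t, ‖v t‖ ≤ K * h := by
    intro t
    have := hu (t + (h : TT)) t
    rw [dist_eq_norm, add_sub_cancel_left] at this
    refine this.trans ?_
    gcongr
    have := (exists_lift (h : TT))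
    rw [AddCircle.norm_eq]
    have h3 := round_le ((2 * Real.pi)⁻¹ * h) 0
    have h4 : |h - round ((2 * Real.pi)⁻¹ * h) * (2 * Real.pi)| =
        (2 * Real.pi) * |(2 * Real.pi)⁻¹ * h - round ((2 * Real.pi)⁻¹ * h)| := by
      rw [← abs_of_pos (show 0 < 2 * Real.pi by positivity), ← abs_mul,
        abs_of_pos (show 0 < 2 * Real.pi by positivity)]
      congr 1
      field_simp
    rw [h4]
    calc _ ≤ (2 * Real.pi) * |(2 * Real.pi)⁻¹ * h - (0 : ℤ)| := by gcongr
      _ = h := by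
        rw [Int.cast_zero, sub_zero, abs_of_pos (by positivity)]
        field_simp
  have hb := bessel v _ hv1 F
  have hc : ∀ n ∈ F, (2 / N) ^ 2 * ((n : ℝ) * ‖fourierCoeff u n‖) ^ 2 ≤
      ‖fourierCoeff v n‖ ^ 2 := by
    intro n hn
    have e1 : fourierCoeff v n = (fourier n (h : TT) - 1) * fourierCoeff u n := by
      rw [hv, fc_sub, sub_mul, one_mul, ← fc_translate]
      rfl
    rw [e1, norm_mul, fourier_real, Complex.norm_exp_I_mul_ofReal_sub_one, norm_mul]
    have e2 : |(n * h / 2 : ℝ)| ≤ Real.pi / 2 := by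
      rw [abs_div, abs_mul, abs_of_pos hpos, abs_two, hh]
      have := hN n hn
      gcongr
      calc |(n : ℝ)| * (Real.pi / N) ≤ N * (Real.pi / N) := by gcongr
        _ = Real.pi := by field_simp
    have e3 := Real.mul_abs_le_abs_sin e2
    have e4 : 2 / Real.pi * |(n * h / 2 : ℝ)| = |(n : ℝ)| / N := by
      rw [abs_div, abs_mul, abs_of_pos hpos, abs_two, hh]
      field_simp
    rw [e4] at e3
    rw [← mul_pow]
    apply sq_le_sq'
    · have : 0 ≤ 2 / N * (|(n : ℝ)| * ‖fourierCoeff u n‖) := by positivity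
      have h5 := neg_abs_le (n : ℝ)
      have h6 : 0 ≤ 2 / N * ‖fourierCoeff u n‖ := by positivity
      have : 2 / N * (|(n : ℝ)| * ‖fourierCoeff u n‖) ≤ ‖(2 : ℝ)‖ * ‖Real.sin (n * h / 2)‖ * ‖fourierCoeff u n‖ := by
        rw [Real.norm_eq_abs (Real.sin _), Real.norm_two]
        calc _ = 2 * (|(n : ℝ)| / N) * ‖fourierCoeff u n‖ := by ring
          _ ≤ _ := by gcongr
      nlinarith [mul_le_mul_of_nonneg_left h5 h6]
    · have : 2 / N * (|(n : ℝ)| * ‖fourierCoeff u n‖) ≤ ‖(2 : ℝ)‖ * ‖Real.sin (n * h / 2)‖ * ‖fourierCoeff u n‖ := by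
        rw [Real.norm_eq_abs (Real.sin _), Real.norm_two]
        calc _ = 2 * (|(n : ℝ)| / N) * ‖fourierCoeff u n‖ := by ring
          _ ≤ _ := by gcongr
      have h5 := le_abs_self (n : ℝ)
      refine le_trans ?_ (this.trans (le_of_eq ?_))
      · gcongr
      · simp
  have h7 := (Finset.sum_le_sum hc).trans hb
  rw [← Finset.mul_sum] at h7
  have h8 : (K * h) ^ 2 = (2 / N) ^ 2 * (Real.pi / 2 * K) ^ 2 := by
    rw [hh]; field_simp; try ring
  rw [h8] at h7
  exact le_of_mul_le_mul_left h7 (by positivity)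

lemma tail_summable {β : ℝ} (hβ0 : 0 ≤ β) (hβ : β < 1 / 2) :
    Summable fun n : ℤ => ((1 + |(n : ℝ)|) ^ β / n) ^ 2 := by
  have h1 := (Real.summable_abs_int_rpow (b := 2 - 2 * β) (by linarith)).mul_left 4
  refine Summable.of_nonneg_of_le (fun n => by positivity) (fun n => ?_) h1
  rcases eq_or_ne n 0 with rfl | hn
  · simp
    positivity
  · have hn1 : (1 : ℝ) ≤ |(n : ℝ)| := by
      have := Int.one_le_abs hn
      exact_mod_cast this
    have hn0 : 0 < |(n : ℝ)| := by linarith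
    have h2 : (1 + |(n : ℝ)|) ^ β ≤ 2 * |(n : ℝ)| ^ β := by
      calc (1 + |(n : ℝ)|) ^ β ≤ (2 * |(n : ℝ)|) ^ β := by
            apply Real.rpow_le_rpow (by positivity) (by linarith) hβ0
        _ = 2 ^ β * |(n : ℝ)| ^ β := Real.mul_rpow (by norm_num) (by positivity)
        _ ≤ 2 ^ (1 : ℝ) * |(n : ℝ)| ^ β := by
            gcongr
            · norm_num
            · linarith
        _ = _ := by simp
    rw [div_pow, ← sq_abs (n : ℝ)]
    have h3 : |(n : ℝ)| ^ (-(2 - 2 * β)) = (|(n : ℝ)| ^ β) ^ 2 / |(n : ℝ)| ^ 2 := by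
      rw [← Real.rpow_natCast, ← Real.rpow_natCast, ← Real.rpow_mul hn0.le, ← Real.rpow_sub hn0]
      congr 1
      push_cast; ring
    rw [h3, ← mul_div_assoc]
    gcongr
    calc _ ≤ (2 * |(n : ℝ)| ^ β) ^ 2 := by gcongr
      _ = _ := by ring

/-- The main estimate for Lipschitz functions. -/
lemma AA_lip {β : ℝ} (hβ0 : 0 ≤ β) (hβ : β < 1 / 2) (η : ℝ) (hη : 0 < η) :
    ∃ C : ℝ, 0 ≤ C ∧ ∀ (u : C(TT, ℂ)) (K M : ℝ), 0 ≤ K → LipR K u → (∀ t, ‖u t‖ ≤ M) →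
      AA β u ≤ ENNReal.ofReal (C * M + η * K) := by
  have hpi := Real.pi_pos
  have hη' : 0 < (η / (Real.pi / 2)) ^ 2 := by positivity
  obtain ⟨S, hS⟩ := summable_iff_vanishing_norm.1 (tail_summable hβ0 hβ) _ hη'
  classical
  set S' := insert 0 S with hS'
  refine ⟨∑ n ∈ S', (1 + |(n : ℝ)|) ^ β, by positivity, fun u K M hK hu hM => ?_⟩
  have hM0 : 0 ≤ M := (norm_nonneg _).trans (hM 0)
  unfold AA WW
  rw [ENNReal.tsum_eq_iSup_sum]
  refine iSup_le fun F => ?_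
  have e1 : ∑ n ∈ F, ‖fourierCoeff u n‖ₑ * ENNReal.ofReal ((1 + |(n : ℝ)|) ^ β) =
      ENNReal.ofReal (∑ n ∈ F, ‖fourierCoeff u n‖ * (1 + |(n : ℝ)|) ^ β) := by
    rw [ENNReal.ofReal_sum_of_nonneg (fun _ _ => by positivity)]
    refine Finset.sum_congr rfl fun n _ => ?_
    rw [ENNReal.ofReal_mul (norm_nonneg _), ofReal_norm]
  rw [e1]
  apply ENNReal.ofReal_le_ofReal
  rw [← Finset.sum_inter_add_sum_sdiff F S']
  apply add_le_add
  · rw [Finset.sum_mul]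
    calc _ ≤ ∑ n ∈ F ∩ S', (1 + |(n : ℝ)|) ^ β * M := by
          refine Finset.sum_le_sum fun n _ => ?_
          rw [mul_comm]
          gcongr
          exact fc_norm_le u M hM n
      _ ≤ _ := Finset.sum_le_sum_of_subset_of_nonneg Finset.inter_subset_right
          (fun _ _ _ => by positivity)
  · set G := F \ S' with hG
    have hd : Disjoint G S := by
      refine Finset.disjoint_left.2 fun n hn hnS => ?_
      rw [hG, Finset.mem_sdiff] at hn
      exact hn.2 (Finset.mem_insert_of_mem hnS)
    have h0 : ∀ n ∈ G, (n : ℝ) ≠ 0 := by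
      intro n hn h
      rw [hG, Finset.mem_sdiff] at hn
      apply hn.2
      have : n = 0 := by exact_mod_cast h
      rw [this]; exact Finset.mem_insert_self _ _
    have h1 := hS G hd
    have h2 := bernstein_sq u K hK hu G
    have h3 := Finset.sum_mul_sq_le_sq_mul_sq G (fun n : ℤ => (n : ℝ) * ‖fourierCoeff u n‖)
      (fun n : ℤ => (1 + |(n : ℝ)|) ^ β / n)
    have h4 : ∑ n ∈ G, ‖fourierCoeff u n‖ * (1 + |(n : ℝ)|) ^ β =
        ∑ n ∈ G, ((n : ℝ) * ‖fourierCoeff u n‖) * ((1 + |(n : ℝ)|) ^ β / n) := by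
      refine Finset.sum_congr rfl fun n hn => ?_
      have := h0 n hn
      field_simp
    rw [h4]
    refine abs_le_of_sq_le_sq' (h3.trans ?_) (by positivity) |>.2
    rw [Real.norm_of_nonneg (Finset.sum_nonneg fun _ _ => by positivity)] at h1
    calc _ ≤ (Real.pi / 2 * K) ^ 2 * (η / (Real.pi / 2)) ^ 2 := by gcongr
      _ = _ := by field_simp

lemma AA_lip_fin {β : ℝ} (hβ0 : 0 ≤ β) (hβ : β < 1 / 2) (u : C(TT, ℂ)) (K : ℝ)
    (hu : LipR K u) : AA β u < ⊤ := by
  obtain ⟨C, _, hC⟩ := AA_lip hβ0 hβ 1 one_pos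
  refine (hC u |K| ‖u‖ (abs_nonneg _) (fun x y => (hu x y).trans ?_)
    (fun t => u.norm_coe_le_norm t)).trans_lt ENNReal.ofReal_lt_top
  gcongr
  exact le_abs_self _

/-- Comparison of the `p`-norm with the weighted `ℓ¹` norm. -/
lemma normA_le_WW {p β : ℝ} (hp : 1 ≤ p) (c : ℤ → ℂ) (h : WW β c < ⊤) :
    MemA p β c ∧ normA p β c ≤ (WW β c).toReal := by
  set x : ℤ → ℝ := fun n => ‖c n‖ * (1 + |(n : ℝ)|) ^ β with hx
  have hx0 : ∀ n, 0 ≤ x n := fun n => by positivity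
  have e0 : ∀ n, (‖c n‖ₑ * ENNReal.ofReal ((1 + |(n : ℝ)|) ^ β)).toReal = x n := by
    intro n
    rw [ENNReal.toReal_mul, toReal_enorm, ENNReal.toReal_ofReal (by positivity)]
  have hs : Summable x := by
    have := ENNReal.summable_toReal h.ne
    simpa only [e0] using this
  have hW : (WW β c).toReal = ∑' n, x n := by
    unfold WW
    rw [ENNReal.tsum_toReal_eq]
    · simp only [e0]
    · intro n; finiteness
  set s := ∑' n, x n with hsdef
  have hs0 : 0 ≤ s := tsum_nonneg hx0
  have e1 : ∀ n : ℤ, ‖c n‖ ^ p * (1 + |(n : ℝ)|) ^ (p * β) = x n ^ p := by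
    intro n
    rw [hx, Real.mul_rpow (by positivity) (by positivity), ← Real.rpow_mul (by positivity), mul_comm β]
  have e2 : ∀ n, x n ^ p ≤ x n * s ^ (p - 1) := by
    intro n
    have h1 : x n ≤ s := hs.le_tsum n (fun j _ => hx0 j)
    calc x n ^ p = x n ^ (1 + (p - 1)) := by congr 1; ring
      _ = x n ^ (1 : ℝ) * x n ^ (p - 1) := Real.rpow_add_of_nonneg (hx0 n) (by norm_num) (by linarith)
      _ = x n * x n ^ (p - 1) := by rw [Real.rpow_one]
      _ ≤ _ := by
        apply mul_le_mul_of_nonneg_left _ (hx0 n)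
        exact Real.rpow_le_rpow (hx0 n) h1 (by linarith)
  have hs2 : Summable fun n => x n ^ p :=
    Summable.of_nonneg_of_le (fun n => Real.rpow_nonneg (hx0 n) _) e2 (hs.mul_right _)
  refine ⟨by unfold MemA; simpa only [e1] using hs2, ?_⟩
  unfold normA wSum
  simp only [e1]
  rw [hW]
  have h3 : ∑' n, x n ^ p ≤ s ^ p := by
    calc _ ≤ ∑' n, x n * s ^ (p - 1) := hs2.tsum_le_tsum e2 (hs.mul_right _)
      _ = s * s ^ (p - 1) := by rw [tsum_mul_right]
      _ = s ^ (1 : ℝ) * s ^ (p - 1) := by rw [Real.rpow_one]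
      _ = s ^ (1 + (p - 1)) := (Real.rpow_add_of_nonneg hs0 (by norm_num) (by linarith)).symm
      _ = s ^ p := by congr 1; ring
  calc _ ≤ (s ^ p) ^ (1 / p) := Real.rpow_le_rpow
          (tsum_nonneg fun n => Real.rpow_nonneg (hx0 n) _) h3 (by positivity)
    _ = s := by rw [← Real.rpow_mul hs0, mul_one_div_cancel (by linarith), Real.rpow_one]

lemma normA_nonneg (p β : ℝ) (c : ℤ → ℂ) : 0 ≤ normA p β c := by
  unfold normA wSum
  exact Real.rpow_nonneg (tsum_nonneg fun n => by positivity) _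

lemma normA_add {p β : ℝ} (hp : 1 ≤ p) (a b : ℤ → ℂ) (ha : MemA p β a) (hb : MemA p β b) :
    normA p β (fun n => a n + b n) ≤ normA p β a + normA p β b := by
  have e1 : ∀ (c : ℤ → ℂ) (n : ℤ), ‖c n‖ ^ p * (1 + |(n : ℝ)|) ^ (p * β) =
      (‖c n‖ * (1 + |(n : ℝ)|) ^ β) ^ p := by
    intro c n
    rw [Real.mul_rpow (by positivity) (by positivity), ← Real.rpow_mul (by positivity), mul_comm β]
  unfold MemA at ha hb
  simp only [e1] at ha hb
  obtain ⟨h1, h2⟩ := Real.Lp_add_le_tsum_of_nonneg hp (fun n => by positivity)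
    (fun n => by positivity) ha hb
  unfold normA wSum
  simp only [e1] 
  refine le_trans ?_ h2
  have e3 : ∀ n : ℤ, (‖a n + b n‖ * (1 + |(n : ℝ)|) ^ β) ^ p ≤
      (‖a n‖ * (1 + |(n : ℝ)|) ^ β + ‖b n‖ * (1 + |(n : ℝ)|) ^ β) ^ p := by
    intro n
    apply Real.rpow_le_rpow (by positivity) _ (by linarith)
    rw [← add_mul]
    gcongr
    exact norm_add_le _ _
  have e4 := Summable.of_nonneg_of_le (fun n => by positivity) e3 h1
  have e5 := e1 (fun n => a n + b n)
  simp only [e5]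
  apply Real.rpow_le_rpow (tsum_nonneg fun n => by positivity) (e4.tsum_le_tsum e3 h1) (by positivity)

lemma LipR.nonneg_const {L : ℝ} {u : TT → ℂ} (h : LipR L u) : LipR |L| u := fun x y =>
  (h x y).trans (by gcongr; exact le_abs_self _)

lemma LipR.add {L M : ℝ} {u v : TT → ℂ} (hu : LipR L u) (hv : LipR M v) :
    LipR (L + M) (fun t => u t + v t) := fun x y => by
  calc ‖u x + v x - (u y + v y)‖ = ‖(u x - u y) + (v x - v y)‖ := by congr 1; ring
    _ ≤ ‖u x - u y‖ + ‖v x - v y‖ := norm_add_le _ _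
    _ ≤ L * dist x y + M * dist x y := add_le_add (hu x y) (hv x y)
    _ = _ := by ring

lemma LipR.mul {L M a b : ℝ} {u v : TT → ℂ} (hu : LipR L u) (hv : LipR M v)
    (ha : ∀ t, ‖u t‖ ≤ a) (hb : ∀ t, ‖v t‖ ≤ b) :
    LipR (a * M + b * L) (fun t => u t * v t) := fun x y => by
  have ha0 : 0 ≤ a := (norm_nonneg _).trans (ha x)
  have hb0 : 0 ≤ b := (norm_nonneg _).trans (hb x)
  calc ‖u x * v x - u y * v y‖ = ‖u x * (v x - v y) + v y * (u x - u y)‖ := by congr 1; ring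
    _ ≤ ‖u x * (v x - v y)‖ + ‖v y * (u x - u y)‖ := norm_add_le _ _
    _ = ‖u x‖ * ‖v x - v y‖ + ‖v y‖ * ‖u x - u y‖ := by rw [norm_mul, norm_mul]
    _ ≤ a * (M * dist x y) + b * (L * dist x y) := by
        gcongr
        · exact ha x
        · exact hv x y
        · exact hb y
        · exact hu x y
    _ = _ := by ring

lemma trigP_lip (S : Finset ℤ) (a : ℤ → ℂ) : ∃ L, LipR L (trigP S a) := by
  classical
  unfold trigP
  induction S using Finset.induction_on with
  | empty => exact ⟨0, fun x y => by simp⟩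
  | insert k S hk ih =>
    obtain ⟨L, hL⟩ := ih
    rw [Finset.sum_insert hk]
    refine ⟨‖a k‖ * |(k : ℝ)| + L, ?_⟩
    refine LipR.add (u := fun t => (a k • (fourier k : C(TT, ℂ))) t) (fun x y => ?_) hL
    have := fourier_lip k x y
    simp only [ContinuousMap.coe_smul, Pi.smul_apply, ← smul_sub]
    rw [norm_smul, mul_assoc]
    gcongr

/-- A bounded Lipschitz inverse away from the zeros. -/
lemma exists_V (P : C(TT, ℂ)) (L : ℝ) (hP : LipR L P) (r : ℝ) (hr : 0 < r) :
    ∃ (V : C(TT, ℂ)) (L' : ℝ), 0 ≤ L' ∧ LipR L' V ∧ (∀ t, ‖V t‖ ≤ r⁻¹) ∧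
      ∀ t, r ≤ ‖P t‖ → P t * V t = 1 := by
  set s : TT → ℂ := fun t => (((max ‖P t‖ r)⁻¹ : ℝ) : ℂ) with hs
  have hm : ∀ t, r ≤ max ‖P t‖ r := fun t => le_max_right _ _
  have hm0 : ∀ t, 0 < max ‖P t‖ r := fun t => hr.trans_le (hm t)
  have hsn : ∀ t, ‖s t‖ = (max ‖P t‖ r)⁻¹ := fun t => by
    rw [hs, Complex.norm_real, Real.norm_of_nonneg (inv_nonneg.2 (hm0 t).le)]
  have hsb : ∀ t, ‖s t‖ ≤ r⁻¹ := fun t => by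
    rw [hsn]; exact inv_anti₀ hr (hm t)
  have hsl : LipR (r⁻¹ * r⁻¹ * L) s := fun x y => by
    have h1 : s x - s y = (((max ‖P x‖ r)⁻¹ * (max ‖P y‖ r)⁻¹ *
        (max ‖P y‖ r - max ‖P x‖ r) : ℝ) : ℂ) := by
      rw [hs]
      simp only
      rw [← Complex.ofReal_sub]
      congr 1
      have := (hm0 x).ne'
      have := (hm0 y).ne'
      field_simp
    rw [h1, Complex.norm_real, norm_mul, norm_mul, mul_assoc (r⁻¹ * r⁻¹)]
    rw [Real.norm_of_nonneg (inv_nonneg.2 (hm0 x).le), Real.norm_of_nonneg (inv_nonneg.2 (hm0 y).le)]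
    have h2 : ‖max ‖P y‖ r - max ‖P x‖ r‖ ≤ L * dist x y := by
      rw [Real.norm_eq_abs, abs_sub_comm]
      exact (abs_max_sub_max_le_abs _ _ _).trans ((abs_norm_sub_norm_le _ _).trans (hP x y))
    have h3 := inv_anti₀ hr (hm x)
    have h4 := inv_anti₀ hr (hm y)
    have h5 := inv_nonneg.2 (hm0 y).le
    gcongr
  have hcl : LipR L (fun t => (starRingEnd ℂ) (P t)) := fun x y => by
    rw [← map_sub, RCLike.norm_conj]; exact hP x y
  have hpb : ∀ t, ‖(starRingEnd ℂ) (P t)‖ ≤ ‖P‖ := fun t => by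
    rw [RCLike.norm_conj]; exact P.norm_coe_le_norm t
  have h1 := hcl.mul hsl hpb hsb
  have h1b : ∀ t, ‖(starRingEnd ℂ) (P t) * s t‖ ≤ 1 := fun t => by
    rw [norm_mul, hsn, RCLike.norm_conj, ← div_eq_mul_inv, div_le_one (hm0 t)]
    exact le_max_left _ _
  have h2 := h1.mul hsl h1b hsb
  obtain ⟨K, hK⟩ := h2.mk'
  refine ⟨⟨_, hK.continuous⟩, _, abs_nonneg _, h2.nonneg_const, fun t => ?_, fun t ht => ?_⟩
  · simp only [ContinuousMap.coe_mk]
    rw [norm_mul]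
    calc _ ≤ 1 * r⁻¹ := mul_le_mul (h1b t) (hsb t) (norm_nonneg _) (by norm_num)
      _ = _ := one_mul _
  · simp only [ContinuousMap.coe_mk]
    have hp0 : 0 < ‖P t‖ := hr.trans_le ht
    rw [hs]
    simp only
    rw [max_eq_left ht, ← mul_assoc, ← mul_assoc, Complex.mul_conj, Complex.normSq_eq_norm_sq,
      ← Complex.ofReal_mul, ← Complex.ofReal_mul]
    norm_cast
    field_simp

lemma LipR.pow {V : C(TT, ℂ)} {L m : ℝ} (hm : 0 < m) (hV : LipR L V) (hb : ∀ t, ‖V t‖ ≤ m)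
    (N : ℕ) : LipR (N * m ^ N * (L / m)) (V ^ N : C(TT, ℂ)) ∧ ∀ t, ‖(V ^ N : C(TT, ℂ)) t‖ ≤ m ^ N := by
  induction N with
  | zero => refine ⟨fun x y => by simp, fun t => by simp⟩
  | succ k ih =>
    obtain ⟨h1, h2⟩ := ih
    constructor
    · have h := h1.mul hV h2 hb
      have e : (m ^ k * L + m * (k * m ^ k * (L / m))) = (k + 1 : ℕ) * m ^ (k + 1) * (L / m) := by
        push_cast
        field_simp
        ring
      rw [e] at h
      intro x y
      have := h x y
      rw [pow_succ]
      exact this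
    · intro t
      rw [pow_succ, pow_succ, ContinuousMap.mul_apply, norm_mul]
      exact mul_le_mul (h2 t) (hb t) (norm_nonneg _) (by positivity)

/-- Local Wiener lemma (Newman's argument). -/
lemma local_wiener {β : ℝ} (hβ0 : 0 ≤ β) (hβ : β < 1 / 2) (f g : C(TT, ℂ)) (hf : AA β f < ⊤)
    (hg : AA β g < ⊤) (δ : ℝ) (hδ : 0 < δ) (hfg : ∀ t, g t ≠ 0 → δ ≤ ‖f t‖)
    (ε : ℝ≥0∞) (hε : 0 < ε) : ∃ h : C(TT, ℂ), AA β h < ⊤ ∧ AA β (g - f * h) < ε := by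
  obtain ⟨S, hS⟩ := AA_trig f hf (ENNReal.ofReal (δ / 3)) (by simpa using by positivity)
  set P := trigP S (fourierCoeff f) with hPdef
  obtain ⟨L, hPL⟩ := trigP_lip S (fourierCoeff f)
  rw [← hPdef] at hPL
  set r := 2 * δ / 3 with hr
  have hr0 : 0 < r := by positivity
  obtain ⟨V, L', hL', hVL, hVb, hPV⟩ := exists_V P L hPL r hr0
  have hV := AA_lip_fin hβ0 hβ V L' hVL
  rw [AA_sub_comm] at hS
  have hPf : AA β (P - f) < ⊤ := hS.trans ENNReal.ofReal_lt_top
  set q := (P - f) * V with hq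
  have hqA : AA β q < ⊤ := (AA_mul hβ0 _ _ hPf).trans_lt (ENNReal.mul_lt_top hPf hV)
  have hPVg : P * V * g = g := by
    ext t
    simp only [ContinuousMap.mul_apply]
    by_cases h0 : g t = 0
    · simp [h0]
    · have h1 := hfg t h0
      have h2 := sup_le_AA hβ0 (P - f) hPf t
      have h3 : ‖(P - f) t‖ ≤ δ / 3 := by
        have h4 := h2.trans hS.le
        rw [← ofReal_norm] at h4
        exact (ENNReal.ofReal_le_ofReal_iff (by positivity)).1 h4
      rw [ContinuousMap.sub_apply] at h3
      have h5 : r ≤ ‖P t‖ := by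
        have h6 := norm_sub_norm_le (f t) (P t)
        rw [norm_sub_rev] at h6
        rw [hr]; linarith
      rw [hPV t h5, one_mul]
  have hsum : ∀ N : ℕ, AA β (∑ k ∈ Finset.range N, q ^ k) < ⊤ := by
    intro N
    induction N with
    | zero => simp [AA_zero]
    | succ k ih =>
      rw [Finset.sum_range_succ]
      refine (AA_add β _ _).trans_lt (ENNReal.add_lt_top.2 ⟨ih, ?_⟩)
      exact (AA_pow hβ0 q hqA k).trans_lt (ENNReal.pow_lt_top hqA)
  have hid : ∀ N : ℕ, g - f * ((∑ k ∈ Finset.range N, q ^ k) * (V * g)) =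
      (P - f) ^ N * (V ^ N * g) := by
    intro N
    have h1 : f * (V * g) = (1 - q) * g := by
      rw [hq]
      calc f * (V * g) = P * V * g - (P - f) * V * g := by ring
        _ = _ := by rw [hPVg]; ring
    have h2 := geom_sum_mul_neg q N
    calc _ = g - (∑ k ∈ Finset.range N, q ^ k) * (f * (V * g)) := by ring
      _ = g - ((∑ k ∈ Finset.range N, q ^ k) * (1 - q)) * g := by rw [h1]; ring
      _ = q ^ N * g := by rw [h2]; ring
      _ = _ := by rw [hq, mul_pow]; ring
  obtain ⟨C, hC0, hC⟩ := AA_lip hβ0 hβ 1 one_pos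
  have hbd : ∀ N : ℕ, AA β ((P - f) ^ N * (V ^ N * g)) ≤
      ENNReal.ofReal ((1 / 2) ^ N * C + N * (1 / 2) ^ N * (L' / r⁻¹)) * AA β g := by
    intro N
    have h1 := LipR.pow (inv_pos.2 hr0) hVL hVb N
    have h2 := hC (V ^ N) _ _ (by positivity) h1.1 h1.2
    have hpN : AA β ((P - f) ^ N) ≤ ENNReal.ofReal ((δ / 3) ^ N) := by
      refine (AA_pow hβ0 _ hPf N).trans ?_
      rw [ENNReal.ofReal_pow (by positivity)]
      gcongr
    have h3 : (δ / 3) ^ N * (C * r⁻¹ ^ N + 1 * (N * r⁻¹ ^ N * (L' / r⁻¹))) =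
        (1 / 2) ^ N * C + N * (1 / 2) ^ N * (L' / r⁻¹) := by
      have : (1 / 2 : ℝ) ^ N = (δ / 3) ^ N * r⁻¹ ^ N := by
        rw [← mul_pow]
        congr 1
        rw [hr]; field_simp
      rw [this]; ring
    calc _ ≤ AA β ((P - f) ^ N) * AA β (V ^ N * g) :=
          AA_mul hβ0 _ _ (hpN.trans_lt ENNReal.ofReal_lt_top)
      _ ≤ AA β ((P - f) ^ N) * (AA β (V ^ N) * AA β g) := by
          gcongr
          exact AA_mul hβ0 _ _ (h2.trans_lt ENNReal.ofReal_lt_top)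
      _ ≤ ENNReal.ofReal ((δ / 3) ^ N) * (ENNReal.ofReal (C * r⁻¹ ^ N + 1 * (N * r⁻¹ ^ N * (L' / r⁻¹))) * AA β g) := by
          gcongr
      _ = _ := by
          rw [← mul_assoc, ← ENNReal.ofReal_mul (by positivity), h3]
  have hlim : Tendsto (fun N : ℕ => ENNReal.ofReal ((1 / 2) ^ N * C + N * (1 / 2) ^ N * (L' / r⁻¹)) * AA β g)
      atTop (𝓝 0) := by
    have h1 : Tendsto (fun N : ℕ => ((1 / 2 : ℝ)) ^ N * C + N * (1 / 2) ^ N * (L' / r⁻¹)) atTop (𝓝 0) := by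
      have e1 := (tendsto_pow_atTop_nhds_zero_of_lt_one (r := (1 / 2 : ℝ)) (by norm_num) (by norm_num)).mul_const C
      have e2 := (tendsto_self_mul_const_pow_of_lt_one (r := (1 / 2 : ℝ)) (by norm_num) (by norm_num)).mul_const (L' / r⁻¹)
      simpa using e1.add e2
    have h2 := ENNReal.tendsto_ofReal h1
    rw [ENNReal.ofReal_zero] at h2
    have h3 := ENNReal.Tendsto.mul_const (b := AA β g) h2 (Or.inr hg.ne)
    simpa using h3
  obtain ⟨N, hN⟩ := (hlim.eventually (gt_mem_nhds hε)).exists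
  refine ⟨(∑ k ∈ Finset.range N, q ^ k) * (V * g), ?_, ?_⟩
  · refine (AA_mul hβ0 _ _ (hsum N)).trans_lt (ENNReal.mul_lt_top (hsum N) ?_)
    exact (AA_mul hβ0 _ _ hV).trans_lt (ENNReal.mul_lt_top hV hg)
  · rw [hid]
    exact (hbd N).trans_lt hN

/-- Soft threshold on the reals. -/
def soft (ε x : ℝ) : ℝ := max (x - ε) 0 - max (-x - ε) 0

lemma soft_lip (ε x y : ℝ) : |soft ε x - soft ε y| ≤ 2 * |x - y| := by
  unfold soft
  have h1 := abs_max_sub_max_le_abs (x - ε) (y - ε) 0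
  have h2 := abs_max_sub_max_le_abs (-x - ε) (-y - ε) 0
  have e1 : x - ε - (y - ε) = x - y := by ring
  have e2 : -x - ε - (-y - ε) = -(x - y) := by ring
  rw [e1] at h1
  rw [e2, abs_neg] at h2
  rw [abs_le] at *
  constructor <;> linarith [h1.1, h1.2, h2.1, h2.2]

lemma soft_close (ε x : ℝ) (hε : 0 < ε) : |soft ε x - x| ≤ ε := by
  unfold soft
  rw [abs_le]
  rcases max_cases (x - ε) 0 with h | h <;> rcases max_cases (-x - ε) 0 with h' | h' <;>
    constructor <;> linarith [h.1, h.2, h'.1, h'.2]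

lemma soft_zero (ε x : ℝ) (h : |x| ≤ ε) : soft ε x = 0 := by
  unfold soft
  rw [abs_le] at h
  rw [max_eq_right (by linarith), max_eq_right (by linarith), sub_zero]

lemma truncation {β : ℝ} (hβ0 : 0 ≤ β) (hβ : β < 1 / 2) (g : C(TT, ℂ)) (K : ℝ) (hg : LipR K g)
    (ε : ℝ≥0∞) (hε : 0 < ε) : ∃ (g1 : C(TT, ℂ)) (K1 r : ℝ), LipR K1 g1 ∧ 0 < r ∧
      AA β (g - g1) < ε ∧ ∀ t, g1 t ≠ 0 → r ≤ ‖g t‖ := by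
  wlog hfin : ε < ⊤ generalizing ε
  · obtain ⟨g1, K1, r, h1, h2, h3, h4⟩ := this 1 one_pos ENNReal.one_lt_top
    exact ⟨g1, K1, r, h1, h2, h3.trans_le (by
      rw [not_lt, top_le_iff] at hfin; rw [hfin]; exact le_top), h4⟩
  set e := ε.toReal with he
  have he0 : 0 < e := ENNReal.toReal_pos hε.ne' hfin.ne
  have hεe : ε = ENNReal.ofReal e := (ENNReal.ofReal_toReal hfin.ne).symm
  set K' := |K| + 4 * |K| with hK'
  have hK'0 : 0 ≤ K' := by positivity
  obtain ⟨C, hC0, hC⟩ := AA_lip hβ0 hβ (e / 4 / (K' + 1)) (by positivity)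
  set r := e / 8 / (C + 1) with hr
  have hr0 : 0 < r := by positivity
  set G : TT → ℂ := fun t => (soft r (g t).re : ℂ) + (soft r (g t).im : ℂ) * Complex.I with hG
  have hGl : LipR (4 * |K|) G := fun x y => by
    have h1 : G x - G y = ((soft r (g x).re - soft r (g y).re : ℝ) : ℂ) +
        ((soft r (g x).im - soft r (g y).im : ℝ) : ℂ) * Complex.I := by
      rw [hG]; push_cast; ring
    rw [h1]
    refine (norm_add_le _ _).trans ?_
    rw [norm_mul, Complex.norm_I, mul_one, Complex.norm_real, Complex.norm_real]
    have h2 := soft_lip r (g x).re (g y).re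
    have h3 := soft_lip r (g x).im (g y).im
    have h4 := Complex.abs_re_le_norm (g x - g y)
    have h5 := Complex.abs_im_le_norm (g x - g y)
    rw [Complex.sub_re] at h4
    rw [Complex.sub_im] at h5
    have h6 := hg.nonneg_const x y
    rw [Real.norm_eq_abs, Real.norm_eq_abs]
    linarith
  obtain ⟨KK, hKK⟩ := hGl.mk'
  refine ⟨⟨G, hKK.continuous⟩, 4 * |K|, r, hGl, hr0, ?_, fun t ht => ?_⟩
  · have h1 : LipR K' (g - ⟨G, hKK.continuous⟩ : C(TT, ℂ)) := fun x y => by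
      have e1 := hg.nonneg_const x y
      have e2 := hGl x y
      simp only [ContinuousMap.sub_apply, ContinuousMap.coe_mk]
      calc _ = ‖(g x - g y) - (G x - G y)‖ := by congr 1; ring
        _ ≤ ‖g x - g y‖ + ‖G x - G y‖ := norm_sub_le _ _
        _ ≤ _ := by rw [hK', add_mul]; exact add_le_add e1 e2
    have h2 : ∀ t, ‖(g - ⟨G, hKK.continuous⟩ : C(TT, ℂ)) t‖ ≤ 2 * r := fun t => by
      simp only [ContinuousMap.sub_apply, ContinuousMap.coe_mk]
      rw [norm_sub_rev]
      have e1 : G t - g t = ((soft r (g t).re - (g t).re : ℝ) : ℂ) +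
        ((soft r (g t).im - (g t).im : ℝ) : ℂ) * Complex.I := by
        rw [hG]
        apply Complex.ext <;> simp
      rw [e1]
      refine (norm_add_le _ _).trans ?_
      rw [norm_mul, Complex.norm_I, mul_one, Complex.norm_real, Complex.norm_real,
        Real.norm_eq_abs, Real.norm_eq_abs]
      linarith [soft_close r (g t).re hr0, soft_close r (g t).im hr0]
    refine (hC _ K' (2 * r) hK'0 h1 h2).trans_lt ?_
    rw [hεe]
    apply (ENNReal.ofReal_lt_ofReal_iff he0).2
    have e1 : C * (2 * r) ≤ e / 4 := by
      have : (C + 1) * (2 * r) = e / 4 := by rw [hr]; field_simp; norm_num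
      nlinarith
    have e2 : e / 4 / (K' + 1) * K' ≤ e / 4 := by
      have : e / 4 / (K' + 1) * (K' + 1) = e / 4 := by field_simp
      have h0 : 0 < e / 4 / (K' + 1) := by positivity
      nlinarith
    linarith
  · by_contra hlt
    push Not at hlt
    apply ht
    simp only [ContinuousMap.coe_mk, hG]
    rw [soft_zero r _ ((Complex.abs_re_le_norm _).trans hlt.le),
      soft_zero r _ ((Complex.abs_im_le_norm _).trans hlt.le)]
    simp

/-- Lipschitz functions vanishing on the zero set lie in the closed ideal. -/
lemma approx_main {β : ℝ} (hβ0 : 0 ≤ β) (hβ : β < 1 / 2) (f g : C(TT, ℂ)) (hf : AA β f < ⊤)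
    (K : ℝ) (hg : LipR K g) (hz : ∀ t, f t = 0 → g t = 0) (ε : ℝ≥0∞) (hε : 0 < ε) (hεf : ε < ⊤) :
    ∃ (S : Finset ℤ) (a : ℤ → ℂ), AA β (g - trigP S a * f) < ε := by
  set e := ε / 3 with he
  have he0 : 0 < e := ENNReal.div_pos hε.ne' (by norm_num)
  obtain ⟨g1, K1, r, hg1, hr, hgg, hsupp⟩ := truncation hβ0 hβ g K hg e he0
  obtain ⟨δ, hδ, hfδ⟩ : ∃ δ : ℝ, 0 < δ ∧ ∀ t, r ≤ ‖g t‖ → δ ≤ ‖f t‖ := by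
    have hcl : IsCompact {t : TT | r ≤ ‖g t‖} :=
      (isClosed_le continuous_const g.continuous.norm).isCompact
    rcases Set.eq_empty_or_nonempty {t : TT | r ≤ ‖g t‖} with h | h
    · refine ⟨1, one_pos, fun t ht => ?_⟩
      have : t ∈ {t : TT | r ≤ ‖g t‖} := ht
      rw [h] at this
      exact this.elim
    · obtain ⟨x, hx, hmin⟩ := hcl.exists_isMinOn h f.continuous.norm.continuousOn
      refine ⟨‖f x‖, ?_, fun t ht => hmin ht⟩
      rw [norm_pos_iff]
      intro h0
      have h1 : r ≤ ‖g x‖ := hx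
      rw [hz x h0, norm_zero] at h1
      linarith
  obtain ⟨h, hhA, hh⟩ := local_wiener hβ0 hβ f g1 hf (AA_lip_fin hβ0 hβ g1 K1 hg1) δ hδ
    (fun t ht => hfδ t (hsupp t ht)) e he0
  have hf1 : AA β f + 1 ≠ ⊤ := by finiteness
  obtain ⟨S, hS⟩ := AA_trig h hhA (e / (AA β f + 1)) (ENNReal.div_pos he0.ne' hf1)
  refine ⟨S, fourierCoeff h, ?_⟩
  set Q := trigP S (fourierCoeff h)
  have h3 : AA β (f * (h - Q)) ≤ e := by
    calc _ ≤ AA β f * AA β (h - Q) := AA_mul hβ0 _ _ hf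
      _ ≤ (AA β f + 1) * (e / (AA β f + 1)) := by
          gcongr
          exact le_self_add
      _ ≤ e := ENNReal.mul_div_le
  have h4 : g - Q * f = (g - g1) + ((g1 - f * h) + f * (h - Q)) := by ring
  rw [h4]
  have e3 : ε = e + (e + e) := by
    rw [he, ← add_assoc, ENNReal.add_thirds]
  rw [e3]
  have hef : e ≠ ⊤ := by rw [he]; finiteness
  refine (AA_add β _ _).trans_lt (ENNReal.add_lt_add hgg ?_)
  exact (AA_add β _ _).trans_lt (ENNReal.add_lt_add_of_lt_of_le (ne_top_of_le_ne_top hef h3) hh h3)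

lemma WW_of_MemA {β : ℝ} (c : ℤ → ℂ) (h : MemA 1 β c) : WW β c < ⊤ := by
  unfold MemA at h
  simp only [Real.rpow_one, one_mul] at h
  unfold WW
  have e : ∀ n : ℤ, ‖c n‖ₑ * ENNReal.ofReal ((1 + |(n : ℝ)|) ^ β) =
      ENNReal.ofReal (‖c n‖ * (1 + |(n : ℝ)|) ^ β) := fun n => by
    rw [ENNReal.ofReal_mul (norm_nonneg _), ofReal_norm]
  simp only [e]
  rw [← ENNReal.ofReal_tsum_of_nonneg (fun n => by positivity) h]
  exact ENNReal.ofReal_lt_top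

lemma exists_fun {β : ℝ} (hβ : 0 ≤ β) (c : ℤ → ℂ) (h : WW β c < ⊤) :
    ∃ f : C(TT, ℂ), fourierCoeff f = c ∧ ∀ t, f t = fSum c t := by
  have hs := summable_of_WW hβ c h
  have hs2 : Summable (fun n => c n • (fourier n : C(TT, ℂ))) := by
    apply Summable.of_norm
    simp_rw [norm_smul, fourier_norm, mul_one]
    exact hs.norm
  refine ⟨∑' n, c n • (fourier n : C(TT, ℂ)), ?_, fun t => ?_⟩
  · ext n
    rw [← coeffL_apply, (coeffL n).map_tsum hs2]
    simp only [map_smul, coeffL_apply, fc_fourier]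
    rw [tsum_eq_single n]
    · simp
    · intro k hk; simp [hk.symm]
  · exact ((ContinuousMap.evalCLM ℂ t).map_tsum hs2)

lemma summable_fc_trigP (S : Finset ℤ) (a : ℤ → ℂ) : Summable (fourierCoeff (trigP S a)) := by
  apply summable_of_hasFiniteSupport
  refine S.finite_toSet.subset fun n hn => ?_
  by_contra h
  apply hn
  rw [fc_trigP, if_neg (by simpa using h)]

theorem stmt13 (p β : ℝ) (hp : 1 ≤ p) (hβ0 : 0 ≤ β) (hβ : β < 1 / 2)
    (E : Set (AddCircle (2 * Real.pi))) (hE : IsClosed E) :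
    (∃ f : ℕ → AddCircle (2 * Real.pi) → ℂ,
      (∀ n : ℕ, ∃ K : NNReal, LipschitzWith K (f n)) ∧
      (∀ n : ℕ, ∀ t ∈ E, f n t = 0) ∧
      Tendsto (fun n : ℕ =>
          normA p β (fun m : ℤ => fourierCoeff (f n) m - if m = 0 then 1 else 0))
        atTop (nhds 0)) ↔
    (∀ c : ℤ → ℂ, MemA 1 β c → zeroSet c = E → IsCyclicA p β c) := by
  constructor
  · rintro ⟨f, hfL, hfE, hlim⟩ c hc hz ε hε
    obtain ⟨n, hn⟩ := (hlim.eventually (gt_mem_nhds (half_pos hε))).exists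
    obtain ⟨K, hK⟩ := hfL n
    set g : C(TT, ℂ) := ⟨f n, hK.continuous⟩ with hg
    have hgL : LipR K g := LipR.of hK
    have hcW := WW_of_MemA c hc
    obtain ⟨F, hF, hFt⟩ := exists_fun hβ0 c hcW
    have hFA : AA β F < ⊤ := by unfold AA; rw [hF]; exact hcW
    obtain ⟨S, a, hSa⟩ := approx_main hβ0 hβ F g hFA K hgL (fun t ht => by
      apply hfE n t
      rw [← hz]
      change fSum c t = 0
      rw [← hFt, ht]) (ENNReal.ofReal (ε / 2)) (by simpa using hε) ENNReal.ofReal_lt_top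
    set b := fourierCoeff (trigP S a) with hb
    refine ⟨b, ?_, ?_⟩
    · refine S.finite_toSet.subset fun k hk => ?_
      by_contra h
      apply hk
      rw [hb, fc_trigP, if_neg (by simpa using h)]
    · set D : C(TT, ℂ) := 1 - g with hD
      have h1 : (1 : C(TT, ℂ)) = fourier 0 := by ext t; simp
      have hDc : ∀ m, fourierCoeff D m = (if m = 0 then 1 else 0) - fourierCoeff (f n) m := fun m => by
        rw [hD, fc_sub, h1, fc_fourier]; rfl
      have hDA : AA β D < ⊤ := (AA_sub β 1 g).trans_lt (ENNReal.add_lt_top.2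
        ⟨by rw [AA_one]; exact ENNReal.one_lt_top, AA_lip_fin hβ0 hβ g K hgL⟩)
      have hDM := normA_le_WW hp (fourierCoeff D) hDA
      have hR := normA_le_WW hp (fourierCoeff (g - trigP S a * F : C(TT, ℂ)))
        (hSa.trans ENNReal.ofReal_lt_top)
      have hadd := normA_add hp _ _ hDM.1 hR.1
      have e1 : (fun m => fourierCoeff D m + fourierCoeff (g - trigP S a * F : C(TT, ℂ)) m) =
          fun m => (if m = 0 then 1 else 0) - convSeq b c m := by
        ext m
        rw [hDc, fc_sub, fc_mul _ _ (summable_fc_trigP S a), hF]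
        simp [hg, hb]
      rw [e1] at hadd
      have e2 : normA p β (fourierCoeff D) =
          normA p β (fun m : ℤ => fourierCoeff (f n) m - if m = 0 then 1 else 0) := by
        unfold normA wSum
        congr 2
        ext m
        rw [hDc, norm_sub_rev]
      have e3 : (WW β (fourierCoeff (g - trigP S a * F : C(TT, ℂ)))).toReal < ε / 2 := by
        have := ENNReal.toReal_strict_mono ENNReal.ofReal_ne_top hSa
        rwa [ENNReal.toReal_ofReal (by positivity)] at this
      rw [e2] at hadd
      linarith [hR.2]
  · intro H
    rcases Set.eq_empty_or_nonempty E with rfl | hne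
    · refine ⟨fun _ _ => 1, fun _ => ⟨0, LipschitzWith.const 1⟩, fun _ t ht => ht.elim, ?_⟩
      have h1 : (fun _ : TT => (1 : ℂ)) = (fourier 0 : C(TT, ℂ)) := by ext t; simp
      have h2 : ∀ m : ℤ, fourierCoeff (fun _ : TT => (1 : ℂ)) m = if m = 0 then 1 else 0 := by
        intro m; rw [h1, fc_fourier]
      have h3 : normA p β (fun _ => 0) = 0 := by
        unfold normA wSum
        have : p ≠ 0 := by linarith
        simp [Real.zero_rpow this, Real.zero_rpow (inv_ne_zero this)]
      simp only [h2, sub_self, h3]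
      exact tendsto_const_nhds
    · set F : C(TT, ℂ) := ⟨fun t => ((Metric.infDist t E : ℝ) : ℂ), by fun_prop⟩ with hFdef
      have hFL : LipR 1 F := fun x y => by
        simp only [hFdef, ContinuousMap.coe_mk]
        rw [← Complex.ofReal_sub, Complex.norm_real]
        have := (Metric.lipschitz_infDist_pt E).dist_le_mul x y
        simpa [Real.dist_eq] using this
      have hFA := AA_lip_fin hβ0 hβ F 1 hFL
      have hz : zeroSet (fourierCoeff F) = E := by
        ext t
        have h1 : fSum (fourierCoeff F) t = F t := by
          have := (has_pointwise_sum_fourier_series_of_summable (summable_of_WW hβ0 _ hFA) t).tsum_eq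
          simpa [fSum] using this
        change fSum (fourierCoeff F) t = 0 ↔ _
        rw [h1, hE.mem_iff_infDist_zero hne]
        simp [hFdef]
      have hcyc := H (fourierCoeff F) (normA_le_WW le_rfl _ hFA).1 hz
      choose a ha hna using fun n : ℕ => hcyc (1 / ((n : ℝ) + 1)) (by positivity)
      set P : ℕ → C(TT, ℂ) := fun n => trigP (ha n).toFinset (a n) with hP
      have hPc : ∀ n, fourierCoeff (P n) = a n := fun n => by
        ext m
        rw [hP, fc_trigP]
        by_cases h : a n m = 0 <;> simp [h]
      refine ⟨fun n => (P n * F : C(TT, ℂ)), fun n => ?_, fun n t ht => ?_, ?_⟩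
      · obtain ⟨L, hL⟩ := trigP_lip (ha n).toFinset (a n)
        exact (LipR.mul hL hFL (fun t => (P n).norm_coe_le_norm t) (fun t => F.norm_coe_le_norm t)).mk'
      · change (P n * F : C(TT, ℂ)) t = 0
        rw [ContinuousMap.mul_apply]
        have : F t = 0 := by
          simp [hFdef, Metric.infDist_zero_of_mem ht]
        rw [this, mul_zero]
      · refine squeeze_zero (fun n => normA_nonneg _ _ _) (fun n => ?_)
          tendsto_one_div_add_atTop_nhds_zero_nat
        refine le_trans (le_of_eq ?_) (hna n).le
        unfold normA wSum
        congr 2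
        ext m
        have h1 : fourierCoeff (P n * F : C(TT, ℂ)) m = convSeq (a n) (fourierCoeff F) m := by
          rw [fc_mul _ _ (summable_fc_trigP _ _), hPc]
        simp only [h1]
        rw [norm_sub_rev]

end
end

section
/- For every λ ∈ [0,1], every positive integer k, and every α ∈ (0,1), one has C_α(S_λ^k) = 0 if and only if α ≥ (1−λ)/(1+λ). -/
open MeasureTheory Real Set Filter Topology ENNReal

noncomputable section

/-- The index set `K_λ^k = {m ∈ ℕ : ∃ j ∈ ℕ*, 2^j ≤ m ≤ 2^j(1+λ+1/j) - k + 1}`. -/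
def Kset (lam : ℝ) (k : ℕ) : Set ℕ :=
  {m | ∃ j : ℕ, 0 < j ∧ (2 : ℝ) ^ j ≤ (m : ℝ) ∧
    (m : ℝ) ≤ (2 : ℝ) ^ j * (1 + lam + 1 / (j : ℝ)) - (k : ℝ) + 1}

/-- The Cantor-type set `S_λ^k ⊆ ℝ/ℤ`: binary expansions `x = ∑ x_i 2^{-(i+1)}`
with digits `x_i ∈ {0,1}` vanishing on `K_λ^k`. -/
def Sset (lam : ℝ) (k : ℕ) : Set (AddCircle (1 : ℝ)) :=
  {y | ∃ x : ℕ → ℕ, (∀ i, x i ≤ 1) ∧ (∀ i ∈ Kset lam k, x i = 0) ∧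
    y = ((∑' i : ℕ, (x i : ℝ) / 2 ^ (i + 1) : ℝ) : AddCircle (1 : ℝ))}

/-- The `k`-fold Minkowski sum `k × E = E + ⋯ + E` in `ℝ/ℤ`. -/
def kFold1 (k : ℕ) (E : Set (AddCircle (1 : ℝ))) : Set (AddCircle (1 : ℝ)) :=
  {x | ∃ g : Fin k → AddCircle (1 : ℝ), (∀ i, g i ∈ E) ∧ x = ∑ i, g i}

/-- Fourier coefficient `μ̂(n)` of a measure on `ℝ/ℤ`. -/
def muHat1 (μ : Measure (AddCircle (1 : ℝ))) (n : ℤ) : ℂ :=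
  ∫ t, fourier (-n) t ∂μ

/-- The `α`-energy `I_α(μ) = ∑_{n ≥ 1} |μ̂(n)|²/(1+n)^{1-α}` of `μ` is finite. -/
def HasFiniteEnergy1 (α : ℝ) (μ : Measure (AddCircle (1 : ℝ))) : Prop :=
  Summable fun n : ℕ => ‖muHat1 μ (n + 1)‖ ^ 2 / (1 + ((n : ℝ) + 1)) ^ (1 - α)

/-- `C_α(E) = 0`: every probability measure supported on a compact subset of `E`
has infinite `α`-energy. -/
def CapacityZero1 (α : ℝ) (E : Set (AddCircle (1 : ℝ))) : Prop :=
  ∀ μ : Measure (AddCircle (1 : ℝ)), IsProbabilityMeasure μ →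
    (∃ K, K ⊆ E ∧ IsCompact K ∧ μ Kᶜ = 0) → ¬ HasFiniteEnergy1 α μ

/-! ### Lower bound for the energy -/

lemma aux_norm_fourier (n : ℤ) (x : AddCircle (1 : ℝ)) : ‖fourier n x‖ = 1 := Circle.norm_coe _

lemma aux_integrable_fourier (μ : Measure (AddCircle (1 : ℝ))) [IsProbabilityMeasure μ] (n : ℤ) :
    Integrable (fun t => fourier n t) μ := by
  refine Integrable.of_bound (C := 1) ?_ ?_
  · exact (fourier n).continuous.aestronglyMeasurable
  · exact ae_of_all _ fun t => (aux_norm_fourier n t).le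

lemma aux_muHat_neg (μ : Measure (AddCircle (1 : ℝ))) (n : ℤ) :
    muHat1 μ (-n) = (starRingEnd ℂ) (muHat1 μ n) := by
  unfold muHat1
  rw [← integral_conj]
  congr 1
  ext t
  rw [← fourier_neg]

lemma aux_norm_muHat_neg (μ : Measure (AddCircle (1 : ℝ))) (n : ℤ) :
    ‖muHat1 μ (-n)‖ = ‖muHat1 μ n‖ := by
  rw [aux_muHat_neg, RCLike.norm_conj]

lemma aux_norm_muHat_le (μ : Measure (AddCircle (1 : ℝ))) [IsProbabilityMeasure μ] (n : ℤ) :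
    ‖muHat1 μ n‖ ≤ 1 := by
  unfold muHat1
  refine (norm_integral_le_of_norm_le_const (C := 1)
    (ae_of_all _ fun t => (aux_norm_fourier (-n) t).le)).trans ?_
  simp

/-- Squared Dirichlet-type kernel. -/
def auxG (M : ℕ) (x y : AddCircle (1 : ℝ)) : ℝ :=
  ‖∑ a ∈ Finset.range M, fourier (a : ℤ) x * fourier (-(a : ℤ)) y‖ ^ 2

lemma auxG_eq (M : ℕ) (x y : AddCircle (1 : ℝ)) :
    (auxG M x y : ℂ) = ∑ a ∈ Finset.range M, ∑ b ∈ Finset.range M,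
      fourier ((a : ℤ) - b) x * fourier (-((a : ℤ) - b)) y := by
  unfold auxG
  push_cast
  rw [← Complex.mul_conj', map_sum, Finset.sum_mul_sum]
  refine Finset.sum_congr rfl fun a _ => Finset.sum_congr rfl fun b _ => ?_
  rw [map_mul, ← fourier_neg, ← fourier_neg, sub_eq_add_neg, fourier_add, neg_add, fourier_add]
  ring

lemma auxG_continuous (M : ℕ) :
    Continuous (fun z : AddCircle (1 : ℝ) × AddCircle (1 : ℝ) => auxG M z.1 z.2) := by
  unfold auxG
  fun_prop

lemma auxG_le (M : ℕ) (x y : AddCircle (1 : ℝ)) : auxG M x y ≤ (M : ℝ) ^ 2 := by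
  unfold auxG
  gcongr
  refine (norm_sum_le _ _).trans ?_
  simp [-fourier_apply, aux_norm_fourier]

lemma auxG_integrable (μ : Measure (AddCircle (1 : ℝ))) [IsProbabilityMeasure μ] (M : ℕ) :
    Integrable (fun z : AddCircle (1 : ℝ) × AddCircle (1 : ℝ) => auxG M z.1 z.2) (μ.prod μ) := by
  refine Integrable.of_bound (C := (M : ℝ) ^ 2) (auxG_continuous M).aestronglyMeasurable ?_
  refine ae_of_all _ fun z => ?_
  rw [Real.norm_of_nonneg (by unfold auxG; positivity)]
  exact auxG_le M _ _

lemma auxG_integral (μ : Measure (AddCircle (1 : ℝ))) [IsProbabilityMeasure μ] (M : ℕ) :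
    ∫ z, auxG M z.1 z.2 ∂(μ.prod μ) = ∑ a ∈ Finset.range M, ∑ b ∈ Finset.range M,
      ‖muHat1 μ ((a : ℤ) - b)‖ ^ 2 := by
  have hfint : ∀ a b : ℕ, Integrable (fun z : AddCircle (1 : ℝ) × AddCircle (1 : ℝ) =>
      fourier ((a : ℤ) - b) z.1 * fourier (-((a : ℤ) - b)) z.2) (μ.prod μ) := fun a b =>
    (aux_integrable_fourier μ _).mul_prod (aux_integrable_fourier μ _)
  have : ((∫ z, auxG M z.1 z.2 ∂(μ.prod μ) : ℝ) : ℂ) =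
      ((∑ a ∈ Finset.range M, ∑ b ∈ Finset.range M, ‖muHat1 μ ((a : ℤ) - b)‖ ^ 2 : ℝ) : ℂ) := by
    rw [← integral_complex_ofReal]
    simp_rw [auxG_eq]
    rw [integral_finsetSum _ (fun a _ => integrable_finsetSum _ fun b _ => hfint a b)]
    push_cast
    refine Finset.sum_congr rfl fun a _ => ?_
    rw [integral_finsetSum _ (fun b _ => hfint a b)]
    refine Finset.sum_congr rfl fun b _ => ?_
    rw [integral_prod_mul (fun x => fourier ((a : ℤ) - b) x)
      (fun y => fourier (-((a : ℤ) - b)) y)]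
    rw [← Complex.conj_mul', ← aux_muHat_neg]
    simp only [muHat1, neg_neg]
  exact_mod_cast this

/-- Closed dyadic arc. -/
def auxArc (m p : ℕ) : Set (AddCircle (1 : ℝ)) :=
  Set.image (fun u : ℝ => (u : AddCircle (1 : ℝ))) <| Icc ((p : ℝ) / 2 ^ m) (((p : ℝ) + 1) / 2 ^ m)

lemma auxArc_meas (m p : ℕ) : MeasurableSet (auxArc m p) :=
  (isCompact_Icc.image (AddCircle.continuous_mk' 1)).measurableSet

lemma auxG_lower (m p : ℕ) (x y : AddCircle (1 : ℝ)) (hx : x ∈ auxArc (m + 3) p)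
    (hy : y ∈ auxArc (m + 3) p) : ((2 : ℝ) ^ m / 2) ^ 2 ≤ auxG (2 ^ m) x y := by
  obtain ⟨u, hu, rfl⟩ := hx
  obtain ⟨v, hv, rfl⟩ := hy
  unfold auxG
  gcongr
  refine le_trans ?_ (Complex.re_le_norm _)
  rw [Complex.re_sum]
  have key : ∀ a ∈ Finset.range (2 ^ m), (1 / 2 : ℝ) ≤
      (fourier (a : ℤ) (u : AddCircle (1 : ℝ)) *
        fourier (-(a : ℤ)) (v : AddCircle (1 : ℝ))).re := by
    intro a ha
    have ha' : (a : ℝ) ≤ 2 ^ m := by exact_mod_cast (Finset.mem_range.1 ha).le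
    have e : (fourier (a : ℤ) (u : AddCircle (1 : ℝ)) *
        fourier (-(a : ℤ)) (v : AddCircle (1 : ℝ))) =
        Complex.exp ((2 * π * a * (u - v) : ℝ) * Complex.I) := by
      rw [fourier_coe_apply, fourier_coe_apply, ← Complex.exp_add]
      congr 1
      push_cast
      ring
    rw [e, Complex.exp_ofReal_mul_I_re, ← Real.cos_abs, ← Real.cos_pi_div_three]
    have huv : |u - v| ≤ 1 / 2 ^ (m + 3) := by
      rw [abs_le]
      have e1 : ((p : ℝ) + 1) / 2 ^ (m + 3) = p / 2 ^ (m + 3) + 1 / 2 ^ (m + 3) := by ring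
      rw [e1] at hu hv
      constructor <;> linarith [hu.1, hu.2, hv.1, hv.2]
    have hb : |2 * π * a * (u - v)| ≤ π / 3 := by
      rw [abs_mul, abs_of_nonneg (by positivity)]
      calc 2 * π * a * |u - v| ≤ 2 * π * 2 ^ m * (1 / 2 ^ (m + 3)) := by gcongr
        _ = π / 4 := by rw [pow_add]; field_simp; norm_num
        _ ≤ π / 3 := by linarith [Real.pi_pos]
    exact Real.cos_le_cos_of_nonneg_of_le_pi (abs_nonneg _) (by linarith [Real.pi_pos]) hb
  calc (2 : ℝ) ^ m / 2 = ∑ a ∈ Finset.range (2 ^ m), (1 / 2 : ℝ) := by simp; ring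
    _ ≤ _ := Finset.sum_le_sum key

lemma aux_energy_lower (μ : Measure (AddCircle (1 : ℝ))) [IsProbabilityMeasure μ] (m : ℕ)
    (P : Finset ℕ) (hP : μ (⋃ p ∈ P, auxArc (m + 3) p)ᶜ = 0) :
    ((2 : ℝ) ^ m / 2) ^ 2 ≤ P.card * ∑ a ∈ Finset.range (2 ^ m), ∑ b ∈ Finset.range (2 ^ m),
      ‖muHat1 μ ((a : ℤ) - b)‖ ^ 2 := by
  classical
  rw [← auxG_integral]
  set f : ℕ → Set (AddCircle (1 : ℝ)) := fun p => if p ∈ P then auxArc (m + 3) p else ∅ with hf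
  set B := disjointed f with hB
  have hfm : ∀ p, MeasurableSet (f p) := by
    intro p; simp only [hf]; split_ifs
    · exact auxArc_meas _ _
    · exact MeasurableSet.empty
  have hBm : ∀ p, MeasurableSet (B p) := fun p => MeasurableSet.disjointed hfm p
  have hBd : Pairwise (Function.onFun Disjoint B) := disjoint_disjointed f
  have hBf : ∀ p, B p ⊆ f p := disjointed_subset f
  have hBU : (⋃ p ∈ P, B p) = ⋃ p ∈ P, auxArc (m + 3) p := by
    have h1 : (⋃ p, B p) = ⋃ p, f p := iUnion_disjointed
    have h2 : (⋃ p, f p) = ⋃ p ∈ P, auxArc (m + 3) p := by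
      ext x; simp [hf]
    have h3 : (⋃ p, B p) = ⋃ p ∈ P, B p := by
      ext x
      simp only [mem_iUnion]
      constructor
      · rintro ⟨p, hp⟩
        refine ⟨p, ?_, hp⟩
        have := hBf p hp
        by_contra hn
        simp [hf, hn] at this
      · rintro ⟨p, _, hp⟩; exact ⟨p, hp⟩
    rw [← h3, h1, h2]
  have hsum : ∑ p ∈ P, μ.real (B p) = 1 := by
    rw [← measureReal_biUnion_finset (fun i _ j _ hij => hBd hij) (fun p _ => hBm p), hBU]
    have hm : MeasurableSet (⋃ p ∈ P, auxArc (m + 3) p) :=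
      Finset.measurableSet_biUnion _ fun p _ => auxArc_meas _ _
    have := (prob_compl_eq_zero_iff hm).1 hP
    simp [Measure.real, this]
  have hCS : (1 : ℝ) ≤ P.card * ∑ p ∈ P, μ.real (B p) ^ 2 := by
    have := sq_sum_le_card_mul_sum_sq (s := P) (f := fun p => μ.real (B p))
    rwa [hsum, one_pow] at this
  set c : ℝ := ((2 : ℝ) ^ m / 2) ^ 2 with hc
  have hc0 : 0 ≤ c := by positivity
  have hlow : ∑ p ∈ P, c * μ.real (B p) ^ 2 ≤ ∫ z, auxG (2 ^ m) z.1 z.2 ∂(μ.prod μ) := by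
    have e : ∀ p ∈ P, c * μ.real (B p) ^ 2 =
        ∫ z, (B p ×ˢ B p).indicator (fun _ => c) z ∂(μ.prod μ) := by
      intro p _
      rw [integral_indicator_const _ ((hBm p).prod (hBm p)), measureReal_prod_prod, smul_eq_mul]
      ring
    have hi : ∀ p ∈ P, Integrable ((B p ×ˢ B p).indicator (fun _ => c)) (μ.prod μ) :=
      fun p _ => (integrable_const c).indicator ((hBm p).prod (hBm p))
    rw [Finset.sum_congr rfl e, ← integral_finsetSum _ hi]
    refine integral_mono (integrable_finsetSum _ hi) (auxG_integrable μ _) ?_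
    rintro ⟨x, y⟩
    simp only
    by_cases h : ∃ p ∈ P, (x, y) ∈ B p ×ˢ B p
    · obtain ⟨p, hp, hxy⟩ := h
      rw [Finset.sum_eq_single p]
      · rw [indicator_of_mem hxy]
        have h1 := hBf p hxy.1
        have h2 := hBf p hxy.2
        simp only [hf, hp, if_true] at h1 h2
        exact auxG_lower m p x y h1 h2
      · intro q _ hq
        refine indicator_of_notMem ?_ _
        intro hxy'
        exact Set.disjoint_left.1 (hBd hq) hxy'.1 hxy.1
      · intro h; exact absurd hp h
    · push Not at h
      rw [Finset.sum_eq_zero fun p hp => indicator_of_notMem (h p hp) _]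
      unfold auxG; positivity
  calc c = c * 1 := by ring
    _ ≤ c * (P.card * ∑ p ∈ P, μ.real (B p) ^ 2) := by gcongr
    _ = P.card * ∑ p ∈ P, c * μ.real (B p) ^ 2 := by rw [← Finset.mul_sum]; ring
    _ ≤ _ := by gcongr

lemma aux_double_sum (h : ℤ → ℝ) (hnn : ∀ n, 0 ≤ h n) (hs : ∀ n, h (-n) = h n) (M : ℕ) :
    ∑ a ∈ Finset.range M, ∑ b ∈ Finset.range M, h ((a : ℤ) - b) ≤
      M * (2 * ∑ n ∈ Finset.range M, h n) := by
  have : ∀ a ∈ Finset.range M, ∑ b ∈ Finset.range M, h ((a : ℤ) - b) ≤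
      2 * ∑ n ∈ Finset.range M, h n := by
    intro a ha
    have ha := Finset.mem_range.1 ha
    have hsplit : ∑ b ∈ Finset.range M, h ((a : ℤ) - b) =
        ∑ b ∈ Finset.range a, h ((a : ℤ) - b) + ∑ b ∈ Finset.Ico a M, h ((a : ℤ) - b) :=
      (Finset.sum_range_add_sum_Ico _ ha.le).symm
    rw [hsplit, two_mul]
    refine add_le_add ?_ ?_
    · have : ∑ b ∈ Finset.range a, h ((a : ℤ) - b) =
          ∑ b ∈ (Finset.range a).image (fun b => a - b), h b := by
        rw [Finset.sum_image]
        · refine Finset.sum_congr rfl fun b hb => ?_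
          rw [Nat.cast_sub (Finset.mem_range.1 hb).le]
        · intro x hx y hy hxy
          simp only [Finset.coe_range, Set.mem_Iio] at hx hy hxy
          omega
      rw [this]
      refine Finset.sum_le_sum_of_subset_of_nonneg ?_ fun _ _ _ => hnn _
      intro x hx
      simp only [Finset.mem_image, Finset.mem_range] at hx ⊢
      omega
    · rw [Finset.sum_Ico_eq_sum_range]
      refine (Finset.sum_le_sum_of_subset_of_nonneg (t := Finset.range M) ?_ ?_).trans
        (le_of_eq ?_)
      · intro x; simp only [Finset.mem_range]; omega
      · intro _ _ _; exact hnn _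
      · refine Finset.sum_congr rfl fun b _ => ?_
        rw [← hs]; congr 1; push_cast; ring
  refine (Finset.sum_le_sum this).trans (le_of_eq ?_)
  simp

lemma aux_finite_energy_bound (μ : Measure (AddCircle (1 : ℝ))) [IsProbabilityMeasure μ]
    (α : ℝ) (hα1 : α < 1) (hE : HasFiniteEnergy1 α μ) :
    ∃ C : ℝ, 0 < C ∧ ∀ (m : ℕ) (P : Finset ℕ), μ (⋃ p ∈ P, auxArc (m + 3) p)ᶜ = 0 →
      ((2 : ℝ) ^ m) ^ α ≤ C * P.card := by
  unfold HasFiniteEnergy1 at hE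
  set t : ℕ → ℝ := fun n => ‖muHat1 μ (n + 1)‖ ^ 2 / (1 + ((n : ℝ) + 1)) ^ (1 - α) with ht
  have ht0 : ∀ n, 0 ≤ t n := fun n => by simp only [ht]; positivity
  set I := ∑' n, t n with hI
  have hI0 : 0 ≤ I := tsum_nonneg ht0
  refine ⟨8 * (1 + I), by positivity, fun m P hP => ?_⟩
  have h1 := aux_energy_lower μ m P hP
  have h2 := aux_double_sum (fun n => ‖muHat1 μ n‖ ^ 2) (fun n => by positivity)
    (fun n => by simp only [aux_norm_muHat_neg]) (2 ^ m)
  have hM1 : (1 : ℝ) ≤ 2 ^ m := one_le_pow₀ (by norm_num)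
  have hMp1 : (1 : ℝ) ≤ ((2 : ℝ) ^ m) ^ (1 - α) := Real.one_le_rpow hM1 (by linarith)
  have h3 : ∑ n ∈ Finset.range (2 ^ m), ‖muHat1 μ n‖ ^ 2 ≤ (1 + I) * ((2 : ℝ) ^ m) ^ (1 - α) := by
    obtain ⟨M', hM'⟩ : ∃ M', 2 ^ m = M' + 1 := ⟨2 ^ m - 1, by have := Nat.one_le_two_pow (n := m); omega⟩
    rw [hM', Finset.sum_range_succ']
    have ha : ∑ n ∈ Finset.range M', ‖muHat1 μ ((n + 1 : ℕ) : ℤ)‖ ^ 2 ≤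
        I * ((2 : ℝ) ^ m) ^ (1 - α) := by
      calc _ ≤ ∑ n ∈ Finset.range M', t n * ((2 : ℝ) ^ m) ^ (1 - α) := by
            refine Finset.sum_le_sum fun n hn => ?_
            have hn := Finset.mem_range.1 hn
            have hle : (1 + ((n : ℝ) + 1)) ≤ 2 ^ m := by
              have : 1 + (n + 1) ≤ 2 ^ m := by omega
              exact_mod_cast this
            have hp : 0 < (1 + ((n : ℝ) + 1)) ^ (1 - α) := by positivity
            simp only [ht]
            push_cast
            rw [div_mul_eq_mul_div, le_div_iff₀ hp]
            refine mul_le_mul_of_nonneg_left ?_ (by positivity)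
            exact Real.rpow_le_rpow (by positivity) hle (by linarith)
        _ = (∑ n ∈ Finset.range M', t n) * ((2 : ℝ) ^ m) ^ (1 - α) := by rw [Finset.sum_mul]
        _ ≤ _ := by
            refine mul_le_mul_of_nonneg_right ?_ (by positivity)
            exact hE.sum_le_tsum _ (fun n _ => ht0 n)
    have hb : ‖muHat1 μ ((0 : ℕ) : ℤ)‖ ^ 2 ≤ 1 :=
      pow_le_one₀ (norm_nonneg _) (aux_norm_muHat_le μ _)
    nlinarith
  push_cast at h2
  have hMα : (2 : ℝ) ^ m = ((2 : ℝ) ^ m) ^ α * ((2 : ℝ) ^ m) ^ (1 - α) := by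
    rw [← Real.rpow_add (by positivity), add_sub_cancel, Real.rpow_one]
  set M : ℝ := (2 : ℝ) ^ m with hM
  set R : ℝ := M ^ (1 - α) with hR
  have hN : (0 : ℝ) ≤ P.card := Nat.cast_nonneg _
  have h4 : (M / 2) ^ 2 ≤ P.card * (M * (2 * ((1 + I) * R))) := by
    refine h1.trans ?_
    refine mul_le_mul_of_nonneg_left (h2.trans ?_) hN
    gcongr
  have h5 : M * (R * M ^ α) ≤ M * (R * (8 * (1 + I) * P.card)) := by
    have : M * (R * M ^ α) = M * M := by rw [mul_comm R, ← hMα]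
    rw [this]
    nlinarith
  exact le_of_mul_le_mul_left (le_of_mul_le_mul_left h5 (by positivity)) (by positivity)

/-! ### Covering count -/

open Classical in
/-- The possible first `m` digits, read as an integer. -/
def auxP (K : Set ℕ) : ℕ → Finset ℕ
  | 0 => {0}
  | m + 1 => (auxP K m).image (fun p => 2 * p) ∪
      (if m ∈ K then ∅ else (auxP K m).image (fun p => 2 * p + 1))

open Classical in
/-- Number of free digits below `m`. -/
def auxFree (K : Set ℕ) (m : ℕ) : ℕ := ((Finset.range m).filter (fun i => i ∉ K)).card

lemma auxP_card (K : Set ℕ) (m : ℕ) : (auxP K m).card ≤ 2 ^ auxFree K m := by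
  classical
  induction m with
  | zero => simp [auxP, auxFree]
  | succ m ih =>
    rw [auxP]
    refine (Finset.card_union_le _ _).trans ?_
    by_cases h : m ∈ K
    · have : auxFree K (m + 1) = auxFree K m := by
        unfold auxFree
        rw [Finset.range_add_one, Finset.filter_insert]
        simp [h]
      simp only [h, if_true, Finset.card_empty, add_zero, this]
      exact Finset.card_image_le.trans ih
    · have : auxFree K (m + 1) = auxFree K m + 1 := by
        unfold auxFree
        rw [Finset.range_add_one, Finset.filter_insert]
        simp [h]
      simp only [h, if_false, this, pow_succ]
      have h1 := (Finset.card_image_le (s := auxP K m) (f := fun p => 2 * p)).trans ih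
      have h2 := (Finset.card_image_le (s := auxP K m) (f := fun p => 2 * p + 1)).trans ih
      omega

lemma auxP_mem (K : Set ℕ) (x : ℕ → ℕ) (hx : ∀ i, x i ≤ 1) (hK : ∀ i ∈ K, x i = 0) (m : ℕ) :
    ∃ p ∈ auxP K m, ∑ i ∈ Finset.range m, (x i : ℝ) / 2 ^ (i + 1) = (p : ℝ) / 2 ^ m := by
  classical
  induction m with
  | zero => exact ⟨0, by simp [auxP], by simp⟩
  | succ m ih =>
    obtain ⟨p, hp, he⟩ := ih
    rw [Finset.sum_range_succ, he]
    have h01 : x m = 0 ∨ x m = 1 := by have := hx m; omega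
    rcases h01 with h | h
    · refine ⟨2 * p, ?_, ?_⟩
      · rw [auxP]
        exact Finset.mem_union_left _ (Finset.mem_image_of_mem _ hp)
      · rw [h, pow_succ]; push_cast; field_simp; ring
    · refine ⟨2 * p + 1, ?_, ?_⟩
      · rw [auxP]
        have : m ∉ K := fun hm => by simp [hK m hm] at h
        simp only [this, if_false]
        exact Finset.mem_union_right _ (Finset.mem_image_of_mem _ hp)
      · rw [h, pow_succ]; push_cast; field_simp

lemma aux_summable_half : Summable (fun i : ℕ => (1 : ℝ) / 2 ^ (i + 1)) := by
  have := (summable_geometric_two).mul_left (1 / 2 : ℝ)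
  refine this.congr fun i => ?_
  rw [pow_succ, one_div_pow]; field_simp

lemma aux_tsum_half : ∑' i : ℕ, (1 : ℝ) / 2 ^ (i + 1) = 1 := by
  have h : ∀ i : ℕ, (1 : ℝ) / 2 ^ (i + 1) = 1 / 2 * (1 / 2) ^ i := fun i => by
    rw [pow_succ, one_div_pow]; field_simp
  simp_rw [h]
  rw [tsum_mul_left, tsum_geometric_two]; norm_num

lemma aux_digit_le (x : ℕ → ℕ) (hx : ∀ i, x i ≤ 1) (i : ℕ) :
    (x i : ℝ) / 2 ^ (i + 1) ≤ 1 / 2 ^ (i + 1) := by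
  have : (x i : ℝ) ≤ 1 := by exact_mod_cast hx i
  gcongr

lemma aux_digit_summable (x : ℕ → ℕ) (hx : ∀ i, x i ≤ 1) :
    Summable (fun i : ℕ => (x i : ℝ) / 2 ^ (i + 1)) :=
  Summable.of_nonneg_of_le (fun i => by positivity) (aux_digit_le x hx) aux_summable_half

lemma auxSset_subset (lam : ℝ) (k m : ℕ) :
    Sset lam k ⊆ ⋃ p ∈ auxP (Kset lam k) m, auxArc m p := by
  rintro y ⟨x, hx, hK, rfl⟩
  obtain ⟨p, hp, he⟩ := auxP_mem _ x hx hK m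
  simp only [mem_iUnion]
  refine ⟨p, hp, _, ?_, rfl⟩
  have hs := aux_digit_summable x hx
  rw [← hs.sum_add_tsum_nat_add m, he]
  have hs' := (summable_nat_add_iff m).2 hs
  have hb : ∑' i : ℕ, (x (i + m) : ℝ) / 2 ^ (i + m + 1) ≤ 1 / 2 ^ m := by
    have hg : ∀ i : ℕ, (x (i + m) : ℝ) / 2 ^ (i + m + 1) ≤ 1 / 2 ^ m * (1 / 2 ^ (i + 1)) := by
      intro i
      refine (aux_digit_le x hx (i + m)).trans (le_of_eq ?_)
      rw [div_mul_div_comm, ← pow_add, one_mul]; congr 2; ring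
    refine (hs'.tsum_le_tsum hg (aux_summable_half.mul_left _)).trans (le_of_eq ?_)
    rw [tsum_mul_left, aux_tsum_half, mul_one]
  have h0 : 0 ≤ ∑' i : ℕ, (x (i + m) : ℝ) / 2 ^ (i + m + 1) := tsum_nonneg fun i => by positivity
  constructor
  · linarith
  · rw [add_div]; linarith

lemma auxFree_mono_add (K : Set ℕ) (s : Finset ℕ) (a b : ℕ)
    (h : ∀ i, a ≤ i → i < b → i ∉ K → i ∈ s) : auxFree K b ≤ auxFree K a + s.card := by
  classical
  unfold auxFree
  refine (Finset.card_le_card ?_).trans (Finset.card_union_le _ _)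
  intro i hi
  simp only [Finset.mem_filter, Finset.mem_range, Finset.mem_union] at hi ⊢
  by_cases hia : i < a
  · exact Or.inl ⟨hia, hi.2⟩
  · exact Or.inr (h i (by omega) hi.1 hi.2)

lemma auxFree_pow (lam : ℝ) (h1 : lam ≤ 1) (k j : ℕ) :
    (auxFree (Kset lam k) (2 ^ (j + 1)) : ℝ) ≤ 2 + (1 - lam) * 2 ^ (j + 1) + k * j := by
  induction j with
  | zero =>
    have : auxFree (Kset lam k) (2 ^ (0 + 1)) ≤ 2 := by
      classical
      unfold auxFree; exact (Finset.card_filter_le _ _).trans (by simp)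
    have h : (auxFree (Kset lam k) (2 ^ (0 + 1)) : ℝ) ≤ 2 := by exact_mod_cast this
    have h' : 0 ≤ (1 - lam) * 2 ^ (0 + 1) := mul_nonneg (by linarith) (by positivity)
    simp only [Nat.cast_zero, mul_zero, add_zero]
    linarith
  | succ j ih =>
    set A := ⌈(2 : ℝ) ^ (j + 1) * (1 + lam)⌉₊ with hA
    have hstep := auxFree_mono_add (Kset lam k) (Finset.Ico (A - k) (2 ^ (j + 2)))
      (2 ^ (j + 1)) (2 ^ (j + 2)) (by
        intro i hi1 hi2 hiK
        rw [Finset.mem_Ico]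
        refine ⟨?_, hi2⟩
        by_contra hlt
        apply hiK
        refine ⟨j + 1, by omega, by exact_mod_cast hi1, ?_⟩
        have hik : i + k < A := by omega
        have := Nat.lt_ceil.1 hik
        push_cast at this
        have hp : (0 : ℝ) ≤ (2 : ℝ) ^ (j + 1) * (1 / ((j + 1 : ℕ) : ℝ)) := by positivity
        rw [mul_add]
        linarith)
    rw [Nat.card_Ico] at hstep
    have hA1 : (2 : ℝ) ^ (j + 1) * (1 + lam) ≤ A := Nat.le_ceil _
    have hA2 : A ≤ 2 ^ (j + 2) := by
      rw [hA, Nat.ceil_le]; push_cast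
      rw [pow_succ (2 : ℝ) (j + 1)]
      have : (0 : ℝ) < 2 ^ (j + 1) := by positivity
      nlinarith
    have h3 : auxFree (Kset lam k) (2 ^ (j + 2)) + A ≤
        auxFree (Kset lam k) (2 ^ (j + 1)) + 2 ^ (j + 2) + k := by omega
    have h4 : (auxFree (Kset lam k) (2 ^ (j + 2)) : ℝ) + A ≤
        auxFree (Kset lam k) (2 ^ (j + 1)) + 2 ^ (j + 2) + k := by exact_mod_cast h3
    have e : (2 : ℝ) ^ (j + 2) = 2 * 2 ^ (j + 1) := by ring
    push_cast
    show (auxFree (Kset lam k) (2 ^ (j + 2)) : ℝ) ≤ 2 + (1 - lam) * 2 ^ (j + 2) + k * (j + 1)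
    rw [e] at h4 ⊢
    nlinarith

/-- First half: zero capacity. -/
lemma aux_zero (lam : ℝ) (h0 : 0 ≤ lam) (h1 : lam ≤ 1) (k : ℕ)
    (α : ℝ) (hα0 : 0 < α) (hα1 : α < 1) (h : (1 - lam) / (1 + lam) ≤ α) :
    CapacityZero1 α (Sset lam k) := by
  rintro μ hμ ⟨E, hES, -, hE0⟩ hfin
  obtain ⟨C, hC, hb⟩ := aux_finite_energy_bound μ α hα1 hfin
  have key : ∀ m : ℕ, α * m ≤ Real.logb 2 C + auxFree (Kset lam k) (m + 3) := by
    intro m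
    have hnull : μ (⋃ p ∈ auxP (Kset lam k) (m + 3), auxArc (m + 3) p)ᶜ = 0 :=
      measure_mono_null (compl_subset_compl.2 (hES.trans (auxSset_subset lam k (m + 3)))) hE0
    have h2 := hb m _ hnull
    have h3 : ((auxP (Kset lam k) (m + 3)).card : ℝ) ≤ 2 ^ auxFree (Kset lam k) (m + 3) := by
      exact_mod_cast auxP_card _ _
    have h4 : ((2 : ℝ) ^ m) ^ α ≤ C * 2 ^ auxFree (Kset lam k) (m + 3) :=
      h2.trans (by gcongr)
    have h5 := Real.logb_le_logb_of_le (b := 2) (by norm_num) (by positivity) h4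
    rw [Real.logb_mul hC.ne' (by positivity), Real.logb_rpow_eq_mul_logb_of_pos (by positivity),
      Real.logb_pow, Real.logb_pow, Real.logb_self_eq_one (by norm_num)] at h5
    linarith
  rw [div_le_iff₀ (by linarith)] at h
  -- bound along the sequence of scales
  have key2 : ∀ j : ℕ, α * 2 ^ (j + 1) / (j + 1) ≤ Real.logb 2 C + 5 + k * j + α * (k + 2) := by
    intro j
    set X : ℝ := (2 : ℝ) ^ (j + 1) * (1 + lam + 1 / ((j + 1 : ℕ) : ℝ)) - k + 1 with hX
    set m := ⌊X⌋₊ with hm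
    have hXm : X < m + 1 := Nat.lt_floor_add_one _
    have h2 := key (m + 1 - 3)
    have hfr : auxFree (Kset lam k) (m + 1 - 3 + 3) ≤ auxFree (Kset lam k) (2 ^ (j + 1)) + 3 := by
      have hstep := auxFree_mono_add (Kset lam k) (Finset.Ico (m + 1) (m + 1 - 3 + 3))
        (2 ^ (j + 1)) (m + 1 - 3 + 3) (by
        intro i hi1 hi2 hiK
        rw [Finset.mem_Ico]
        refine ⟨?_, hi2⟩
        by_contra hlt
        apply hiK
        refine ⟨j + 1, by omega, by exact_mod_cast hi1, ?_⟩
        have : i ≤ m := by omega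
        have h2pos : 1 ≤ 2 ^ (j + 1) := Nat.one_le_two_pow
        exact (Nat.le_floor_iff' (by omega)).1 this)
      rw [Nat.card_Ico] at hstep
      omega
    have hfr' : (auxFree (Kset lam k) (m + 1 - 3 + 3) : ℝ) ≤
        auxFree (Kset lam k) (2 ^ (j + 1)) + 3 := by exact_mod_cast hfr
    have hp := auxFree_pow lam h1 k j
    have hms : (m : ℝ) + 1 - 3 ≤ ((m + 1 - 3 : ℕ) : ℝ) := by
      have : m + 1 ≤ (m + 1 - 3) + 3 := by omega
      have : (m : ℝ) + 1 ≤ ((m + 1 - 3 : ℕ) : ℝ) + 3 := by exact_mod_cast this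
      linarith
    have h6 : α * (X - 3) ≤ α * ((m + 1 - 3 : ℕ) : ℝ) := by
      refine mul_le_mul_of_nonneg_left ?_ hα0.le
      linarith
    have h7 : (1 - lam) * 2 ^ (j + 1) ≤ α * (1 + lam) * 2 ^ (j + 1) := by gcongr
    have h8 : α * (X - 3) = α * (1 + lam) * 2 ^ (j + 1) + α * 2 ^ (j + 1) / (j + 1)
        - α * (k + 2) := by
      rw [hX]; push_cast; field_simp; ring
    linarith
  set D : ℝ := (|Real.logb 2 C| + 5 + k + α * (k + 2)) / α with hD
  have hD0 : 0 < D := by positivity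
  have key3 : ∀ j : ℕ, (2 : ℝ) ^ (j + 1) ≤ D * ((j + 1 : ℕ) : ℝ) ^ 2 := by
    intro j
    have hk2 := key2 j
    have hj : (0 : ℝ) < (j : ℝ) + 1 := by positivity
    have hj0 : (0 : ℝ) ≤ (j : ℝ) := by positivity
    have hle : Real.logb 2 C + 5 + k * j + α * (k + 2) ≤
        (|Real.logb 2 C| + 5 + k + α * (k + 2)) * (j + 1) := by
      have ha := le_abs_self (Real.logb 2 C)
      have hb : 0 ≤ (|Real.logb 2 C| + 5 + α * (k + 2)) * j := by positivity
      have hk0 : (0 : ℝ) ≤ k := by positivity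
      nlinarith
    have h9 := hk2.trans hle
    rw [div_le_iff₀ hj] at h9
    rw [hD, div_mul_eq_mul_div, le_div_iff₀ hα0]
    push_cast
    nlinarith
  have hlim := (tendsto_pow_const_div_const_pow_of_one_lt 2 (r := (2 : ℝ)) (by norm_num))
  have hev := (hlim.eventually (gt_mem_nhds (show (0 : ℝ) < 1 / D by positivity))).and
    (eventually_ge_atTop 1)
  obtain ⟨n, hn, hn1⟩ := hev.exists
  obtain ⟨j, rfl⟩ : ∃ j, n = j + 1 := ⟨n - 1, by omega⟩
  rw [div_lt_div_iff₀ (by positivity) hD0] at hn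
  have := key3 j
  linarith

/-! ### Construction of a measure of finite energy -/

open Classical in
/-- Digits associated with a coin-tossing sequence. -/
def auxD (K : Set ℕ) (b : ℕ → Bool) (i : ℕ) : ℕ := if i ∈ K then 0 else (b i).toNat

lemma auxD_le (K : Set ℕ) (b : ℕ → Bool) (i : ℕ) : auxD K b i ≤ 1 := by
  unfold auxD; split_ifs
  · exact Nat.zero_le _
  · exact Bool.toNat_le _

/-- The coding map. -/
def auxPhi (K : Set ℕ) (b : ℕ → Bool) : AddCircle (1 : ℝ) :=
  ((∑' i : ℕ, (auxD K b i : ℝ) / 2 ^ (i + 1) : ℝ) : AddCircle (1 : ℝ))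

lemma auxPhi_mem (lam : ℝ) (k : ℕ) (b : ℕ → Bool) : auxPhi (Kset lam k) b ∈ Sset lam k :=
  ⟨auxD (Kset lam k) b, auxD_le _ b, fun i hi => by simp [auxD, hi], rfl⟩

lemma auxPhi_continuous (K : Set ℕ) : Continuous (auxPhi K) := by
  unfold auxPhi
  refine (AddCircle.continuous_mk' 1).comp ?_
  refine continuous_tsum (u := fun i : ℕ => (1 : ℝ) / 2 ^ (i + 1)) ?_ aux_summable_half ?_
  · intro i
    refine Continuous.div_const ?_ _
    have : (fun b : ℕ → Bool => ((auxD K b i : ℕ) : ℝ)) =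
        (fun c : Bool => ((auxD K (fun _ => c) i : ℕ) : ℝ)) ∘ (fun b : ℕ → Bool => b i) := by
      ext b; simp [auxD]
    rw [this]
    exact continuous_of_discreteTopology.comp (continuous_apply i)
  · intro i b
    rw [Real.norm_of_nonneg (by positivity)]
    exact aux_digit_le _ (auxD_le K b) i

/-- Fair coin. -/
def auxCoin : Measure Bool := (PMF.uniformOfFintype Bool).toMeasure

instance : IsProbabilityMeasure auxCoin := by unfold auxCoin; infer_instance

lemma auxCoin_integral (g : Bool → ℂ) : ∫ c, g c ∂auxCoin = (g true + g false) / 2 := by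
  unfold auxCoin
  rw [PMF.integral_eq_sum]
  simp
  ring

/-- Coin tossing space. -/
def auxCoins : Measure (ℕ → Bool) := Measure.infinitePi (fun _ : ℕ => auxCoin)

instance : IsProbabilityMeasure auxCoins := by unfold auxCoins; infer_instance

/-- The natural measure on the Cantor-type set. -/
def auxMu (K : Set ℕ) : Measure (AddCircle (1 : ℝ)) := auxCoins.map (auxPhi K)

instance (K : Set ℕ) : IsProbabilityMeasure (auxMu K) :=
  Measure.isProbabilityMeasure_map (auxPhi_continuous K).measurable.aemeasurable

lemma auxMu_supp (K : Set ℕ) : auxMu K (range (auxPhi K))ᶜ = 0 := by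
  have hm : MeasurableSet (range (auxPhi K)) :=
    (isCompact_range (auxPhi_continuous K)).measurableSet
  unfold auxMu
  rw [Measure.map_apply (auxPhi_continuous K).measurable hm.compl]
  have : auxPhi K ⁻¹' (range (auxPhi K))ᶜ = ∅ := by
    ext b; simp
  rw [this, measure_empty]

open Classical in
/-- Squared modulus of the Fourier factor of digit `i`. -/
def auxC (K : Set ℕ) (i n : ℕ) : ℝ :=
  if i ∈ K then 1 else Real.cos (π * n / 2 ^ (i + 1)) ^ 2

lemma auxC_nonneg (K : Set ℕ) (i n : ℕ) : 0 ≤ auxC K i n := by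
  unfold auxC; split_ifs <;> positivity

lemma auxC_le (K : Set ℕ) (i n : ℕ) : auxC K i n ≤ 1 := by
  unfold auxC; split_ifs
  · exact le_rfl
  · exact Real.cos_sq_le_one _

lemma aux_fourier_add (n : ℤ) (x y : AddCircle (1 : ℝ)) :
    fourier n (x + y) = fourier n x * fourier n y := by
  simp only [fourier_apply, smul_add, AddCircle.toCircle_add, Circle.coe_mul]

lemma aux_fourier_sum (n : ℤ) (f : ℕ → ℝ) (m : ℕ) :
    fourier n ((∑ i ∈ Finset.range m, f i : ℝ) : AddCircle (1 : ℝ)) =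
      ∏ i ∈ Finset.range m, fourier n ((f i : ℝ) : AddCircle (1 : ℝ)) := by
  induction m with
  | zero =>
    simp only [Finset.range_zero, Finset.sum_empty, Finset.prod_empty]
    exact fourier_eval_zero n
  | succ m ih =>
    rw [Finset.sum_range_succ, Finset.prod_range_succ, AddCircle.coe_add, aux_fourier_add, ih]

/-- Fourier factor of digit `i`. -/
def auxg (K : Set ℕ) (n : ℤ) (i : ℕ) (c : Bool) : ℂ :=
  fourier n (((auxD K (fun _ => c) i : ℝ) / 2 ^ (i + 1) : ℝ) : AddCircle (1 : ℝ))

lemma auxg_integral (K : Set ℕ) (n i : ℕ) :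
    ‖∫ c, auxg K (-(n : ℤ)) i c ∂auxCoin‖ ^ 2 = auxC K i n := by
  rw [auxCoin_integral]
  unfold auxg auxC auxD
  by_cases h : i ∈ K
  · simp only [h, if_true, Nat.cast_zero, zero_div, AddCircle.coe_zero]
    rw [fourier_eval_zero]; norm_num
  · simp only [h, if_false, Bool.toNat_true, Bool.toNat_false, Nat.cast_zero, zero_div,
      AddCircle.coe_zero, Nat.cast_one]
    rw [fourier_eval_zero, fourier_coe_apply]
    have e : (2 * (π : ℂ) * Complex.I * ((-(n : ℤ) : ℤ) : ℂ) * ((1 / 2 ^ (i + 1) : ℝ) : ℂ) / (1 : ℝ))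
        = ((-(2 * (π * n / 2 ^ (i + 1))) : ℝ) : ℂ) * Complex.I := by
      push_cast; ring
    rw [e, norm_div, div_pow, ← Complex.normSq_eq_norm_sq, Complex.normSq_apply]
    simp only [Complex.add_re, Complex.add_im, Complex.exp_ofReal_mul_I_re,
      Complex.exp_ofReal_mul_I_im, Complex.one_re, Complex.one_im, Real.cos_neg, Real.sin_neg]
    set θ := π * (n : ℝ) / 2 ^ (i + 1)
    rw [Real.cos_two_mul, Real.sin_two_mul]
    have hs := Real.sin_sq_add_cos_sq θ
    have : Real.sin θ ^ 2 = 1 - Real.cos θ ^ 2 := by linarith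
    norm_num
    ring_nf
    rw [this]
    ring

lemma aux_finite_prod (g : ℕ → Bool → ℂ) (m : ℕ) :
    ∫ b, ∏ i ∈ Finset.range m, g i (b i) ∂auxCoins =
      ∏ i ∈ Finset.range m, ∫ c, g i c ∂auxCoin := by
  unfold auxCoins
  have h1 : ∀ b : ℕ → Bool, ∏ i ∈ Finset.range m, g i (b i) =
      (fun y : (i : Finset.range m) → Bool => ∏ i : Finset.range m, g i (y i)) ((Finset.range m).restrict b) := by
    intro b
    simp only [Finset.restrict]
    exact (Finset.prod_coe_sort (Finset.range m) (fun i => g i (b i))).symm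
  simp_rw [h1]
  rw [integral_restrict_infinitePi (μ := fun _ : ℕ => auxCoin) (s := Finset.range m)
    (f := fun y : (i : Finset.range m) → Bool => ∏ i : Finset.range m, g i (y i))]
  · rw [integral_fintype_prod_eq_prod (fun i : Finset.range m => g i)]
    exact Finset.prod_coe_sort (Finset.range m) (fun i => ∫ c, g i c ∂auxCoin)
  · exact (measurable_of_finite _).aestronglyMeasurable

lemma auxMu_hat_le (K : Set ℕ) (n m : ℕ) :
    ‖muHat1 (auxMu K) n‖ ^ 2 ≤ ∏ i ∈ Finset.range m, auxC K i n := by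
  have hfint : muHat1 (auxMu K) n = ∫ b, fourier (-(n : ℤ)) (auxPhi K b) ∂auxCoins := by
    unfold muHat1 auxMu
    rw [integral_map (auxPhi_continuous K).measurable.aemeasurable]
    exact (fourier (-(n : ℤ))).continuous.aestronglyMeasurable
  have hlim : Tendsto (fun M : ℕ => ∏ i ∈ Finset.range M, ∫ c, auxg K (-(n : ℤ)) i c ∂auxCoin)
      atTop (𝓝 (muHat1 (auxMu K) n)) := by
    rw [hfint]
    simp_rw [← aux_finite_prod]
    refine tendsto_integral_of_dominated_convergence (fun _ => 1) ?_ (integrable_const _) ?_ ?_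
    · intro M
      refine Measurable.aestronglyMeasurable ?_
      refine Finset.measurable_prod _ fun i _ => ?_
      exact (measurable_of_finite (auxg K (-(n : ℤ)) i)).comp (measurable_pi_apply i)
    · intro M
      refine ae_of_all _ fun b => ?_
      rw [norm_prod]
      simp only [auxg, aux_norm_fourier, Finset.prod_const_one, le_refl]
    · refine ae_of_all _ fun b => ?_
      have hs := (aux_digit_summable _ (auxD_le K b)).hasSum.tendsto_sum_nat
      have hc : Continuous (fun u : ℝ => fourier (-(n : ℤ)) (u : AddCircle (1 : ℝ))) :=
        (fourier (-(n : ℤ))).continuous.comp (AddCircle.continuous_mk' 1)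
      have := (hc.tendsto _).comp hs
      refine this.congr fun M => ?_
      simp only [Function.comp]
      rw [aux_fourier_sum]
      rfl
  have hlim2 := (hlim.norm.pow 2)
  refine le_of_tendsto hlim2 ?_
  filter_upwards [eventually_ge_atTop m] with M hM
  rw [norm_prod, ← Finset.prod_pow]
  simp_rw [auxg_integral]
  rw [← Finset.prod_range_mul_prod_Ico _ hM]
  refine mul_le_of_le_one_right (Finset.prod_nonneg fun i _ => auxC_nonneg K i n) ?_
  exact Finset.prod_le_one (fun i _ => auxC_nonneg K i n) fun i _ => auxC_le K i n

open Classical in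
/-- Number of forced digits below `m`. -/
def auxKap (K : Set ℕ) (m : ℕ) : ℕ := ((Finset.range m).filter (fun i => i ∈ K)).card

lemma auxC_periodic (K : Set ℕ) (i n m : ℕ) (h : i < m) : auxC K i (2 ^ m + n) = auxC K i n := by
  unfold auxC
  split_ifs
  · rfl
  · obtain ⟨d, rfl⟩ : ∃ d, m = i + 1 + d := ⟨m - (i + 1), by omega⟩
    have : π * ((2 ^ (i + 1 + d) + n : ℕ) : ℝ) / 2 ^ (i + 1) =
        π * n / 2 ^ (i + 1) + (2 ^ d : ℕ) * π := by
      push_cast; rw [pow_add]; field_simp; ring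
    rw [this, Real.cos_add_nat_mul_pi, mul_pow, ← pow_mul, mul_comm _ 2, pow_mul]
    norm_num

lemma aux_sum_prod (K : Set ℕ) (m : ℕ) :
    ∑ n ∈ Finset.range (2 ^ m), ∏ i ∈ Finset.range m, auxC K i n = 2 ^ auxKap K m := by
  classical
  induction m with
  | zero => simp [auxKap]
  | succ m ih =>
    rw [pow_succ, mul_two, Finset.sum_range_add, ← Finset.sum_add_distrib]
    have hper : ∀ n, ∏ i ∈ Finset.range m, auxC K i (2 ^ m + n) =
        ∏ i ∈ Finset.range m, auxC K i n := fun n =>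
      Finset.prod_congr rfl fun i hi => auxC_periodic K i n m (Finset.mem_range.1 hi)
    simp_rw [Finset.prod_range_succ, hper, ← mul_add]
    have hsum : ∀ n, auxC K m n + auxC K m (2 ^ m + n) = if m ∈ K then 2 else 1 := by
      intro n
      unfold auxC
      split_ifs
      · norm_num
      · have : π * ((2 ^ m + n : ℕ) : ℝ) / 2 ^ (m + 1) = π * n / 2 ^ (m + 1) + π / 2 := by
          push_cast; rw [pow_succ]; field_simp; ring
        rw [this, Real.cos_add_pi_div_two, neg_sq, Real.cos_sq_add_sin_sq]
    simp_rw [hsum, ← Finset.sum_mul, ih]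
    unfold auxKap
    rw [Finset.range_add_one, Finset.filter_insert]
    by_cases h : m ∈ K
    · simp [h, pow_succ]
    · simp [h]

lemma auxMu_sum_le (K : Set ℕ) (m : ℕ) :
    ∑ n ∈ Finset.range (2 ^ m), ‖muHat1 (auxMu K) n‖ ^ 2 ≤ 2 ^ auxKap K m := by
  rw [← aux_sum_prod]
  exact Finset.sum_le_sum fun n _ => auxMu_hat_le K n m

lemma auxKap_add (K : Set ℕ) (s : Finset ℕ) (a b : ℕ)
    (h : ∀ i, a ≤ i → i < b → i ∈ K → i ∈ s) : auxKap K b ≤ auxKap K a + s.card := by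
  classical
  unfold auxKap
  refine (Finset.card_le_card ?_).trans (Finset.card_union_le _ _)
  intro i hi
  simp only [Finset.mem_filter, Finset.mem_range, Finset.mem_union] at hi ⊢
  by_cases hia : i < a
  · exact Or.inl ⟨hia, hi.2⟩
  · exact Or.inr (h i (by omega) hi.1 hi.2)

lemma auxKap_le (K : Set ℕ) (m : ℕ) : auxKap K m ≤ m := by
  classical
  unfold auxKap
  exact (Finset.card_filter_le _ _).trans (by simp)

/-- In a large dyadic block, forced digits are near the beginning. -/
lemma aux_block (lam L : ℝ) (h1 : lam ≤ 1) (hL : lam < L) (hL1 : L < 1)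
    (k : ℕ) (hk : 0 < k) :
    ∃ J0 : ℕ, ∀ J, J0 ≤ J → ∀ i, 2 ^ J ≤ i → i < 2 ^ (J + 1) → i ∈ Kset lam k →
      i < 2 ^ J + ⌊(2 : ℝ) ^ J * L⌋₊ := by
  have hk' : (1 : ℝ) ≤ k := by exact_mod_cast hk
  have hlim : Tendsto (fun j : ℕ => lam + 1 / (j : ℝ) + (1 / 2 : ℝ) ^ j) atTop (𝓝 (lam + 0 + 0)) :=
    (tendsto_const_nhds.add tendsto_one_div_atTop_nhds_zero_nat).add
      (tendsto_pow_atTop_nhds_zero_of_lt_one (by norm_num) (by norm_num))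
  have hev := hlim.eventually (gt_mem_nhds (show lam + 0 + 0 < L by linarith))
  obtain ⟨J1, hJ1⟩ := eventually_atTop.1 hev
  have hJ1' : ∀ j, J1 ≤ j → (2 : ℝ) ^ j * (1 + lam + 1 / j) + 1 ≤ 2 ^ j + 2 ^ j * L := by
    intro j hj
    have h2 := (hJ1 j hj).le
    have h3 : (2 : ℝ) ^ j * (lam + 1 / (j : ℝ) + (1 / 2 : ℝ) ^ j) ≤ 2 ^ j * L := by gcongr
    have h4 : (2 : ℝ) ^ j * (1 / 2 : ℝ) ^ j = 1 := by rw [← mul_pow]; norm_num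
    nlinarith
  refine ⟨J1 + 2, fun J hJ i hi1 hi2 hiK => ?_⟩
  obtain ⟨j, hj0, hj1, hj2⟩ := hiK
  have hj2' : (i : ℝ) ≤ 2 ^ j * (1 + lam + 1 / (j : ℝ)) := by linarith
  have hjJ : j ≤ J := by
    have h2 : 2 ^ j ≤ i := by exact_mod_cast hj1
    have h3 : 2 ^ j < 2 ^ (J + 1) := by omega
    have := (Nat.pow_lt_pow_iff_right (by norm_num : 1 < 2)).1 h3
    omega
  have hjJ1 : J1 ≤ j := by
    by_contra hlt
    have h2 : (i : ℝ) ≤ 2 ^ j * 3 := by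
      refine hj2'.trans ?_
      gcongr
      have : 1 / (j : ℝ) ≤ 1 := by
        rw [div_le_one (by exact_mod_cast hj0)]; exact_mod_cast hj0
      linarith
    have h3 : i ≤ 2 ^ j * 3 := by exact_mod_cast h2
    have h4 : 2 ^ (j + 2) ≤ 2 ^ J := Nat.pow_le_pow_right (by norm_num) (by omega)
    have h5 : 2 ^ (j + 2) = 2 ^ j * 4 := by ring
    have h6 : 0 < 2 ^ j := by positivity
    omega
  have h7 := hJ1' j hjJ1
  have h8 : (i : ℝ) + 1 ≤ 2 ^ j + 2 ^ j * L := by linarith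
  have hjeq : j = J := by
    by_contra hne
    have h4 : 2 ^ (j + 1) ≤ 2 ^ J := Nat.pow_le_pow_right (by norm_num) (by omega)
    have h5 : (2 : ℝ) ^ (j + 1) ≤ i := by exact_mod_cast h4.trans hi1
    rw [pow_succ] at h5
    have h6 : (0 : ℝ) < 2 ^ j := by positivity
    nlinarith
  subst hjeq
  have h9 : i + 1 - 2 ^ j ≤ ⌊(2 : ℝ) ^ j * L⌋₊ := by
    refine Nat.le_floor ?_
    rw [Nat.cast_sub (by omega)]
    push_cast
    linarith
  omega

lemma auxKap_bound (lam β : ℝ) (h0 : 0 ≤ lam) (h1 : lam ≤ 1) (k : ℕ) (hk : 0 < k)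
    (hβ : 2 * lam / (1 + lam) < β) (hβ1 : β < 1) :
    ∃ C : ℕ, ∀ m : ℕ, (auxKap (Kset lam k) m : ℝ) ≤ C + β * m := by
  have hβ0 : 0 < β := lt_of_le_of_lt (by positivity) hβ
  rw [div_lt_iff₀ (by linarith)] at hβ
  set L : ℝ := β / (2 - β) with hLdef
  have hLβ : L * (2 - β) = β := by rw [hLdef, div_mul_cancel₀]; linarith
  have hL : lam < L := by rw [hLdef, lt_div_iff₀ (by linarith)]; linarith
  have hL1 : L < 1 := by rw [hLdef, div_lt_one (by linarith)]; linarith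
  obtain ⟨J0, hJ0⟩ := aux_block lam L h1 hL hL1 k hk
  have hL0 : 0 ≤ L := by linarith
  have step : ∀ J, J0 ≤ J → ∀ m, m ≤ 2 ^ (J + 1) →
      auxKap (Kset lam k) m ≤ auxKap (Kset lam k) (2 ^ J) + ⌊(2 : ℝ) ^ J * L⌋₊ := by
    intro J hJ m hm
    have := auxKap_add (Kset lam k) (Finset.Ico (2 ^ J) (2 ^ J + ⌊(2 : ℝ) ^ J * L⌋₊)) (2 ^ J) m
      (fun i hi1 hi2 hiK => Finset.mem_Ico.2 ⟨hi1, hJ0 J hJ i hi1 (by omega) hiK⟩)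
    rw [Nat.card_Ico] at this
    omega
  have hfl : ∀ J : ℕ, (⌊(2 : ℝ) ^ J * L⌋₊ : ℝ) ≤ 2 ^ J * L := fun J =>
    Nat.floor_le (by positivity)
  have hpow : ∀ J, J0 ≤ J → (auxKap (Kset lam k) (2 ^ J) : ℝ) ≤ (2 ^ J0 : ℕ) + 2 ^ J * L := by
    intro J hJ
    induction J, hJ using Nat.le_induction with
    | base =>
      have : (auxKap (Kset lam k) (2 ^ J0) : ℝ) ≤ (2 ^ J0 : ℕ) := by exact_mod_cast auxKap_le _ _
      have : 0 ≤ (2 : ℝ) ^ J0 * L := by positivity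
      linarith
    | succ J hJ ih =>
      have h2 : (auxKap (Kset lam k) (2 ^ (J + 1)) : ℝ) ≤
          auxKap (Kset lam k) (2 ^ J) + ⌊(2 : ℝ) ^ J * L⌋₊ := by
        exact_mod_cast step J hJ _ le_rfl
      have h3 := hfl J
      have e : (2 : ℝ) ^ (J + 1) = 2 * 2 ^ J := by ring
      rw [e]
      linarith
  refine ⟨2 ^ J0, fun m => ?_⟩
  by_cases hm : m < 2 ^ J0
  · have : (auxKap (Kset lam k) m : ℝ) ≤ (2 ^ J0 : ℕ) := by
      exact_mod_cast (auxKap_le _ m).trans hm.le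
    have : 0 ≤ β * m := by positivity
    linarith
  · have hm0 : m ≠ 0 := by have : 0 < 2 ^ J0 := by positivity
                           omega
    set J := Nat.log 2 m with hJdef
    have hJ : J0 ≤ J := (Nat.le_log_iff_pow_le (by norm_num) hm0).2 (by omega)
    have hmJ : 2 ^ J ≤ m := Nat.pow_log_le_self 2 hm0
    have hmJ2 : m < 2 ^ (J + 1) := Nat.lt_pow_succ_log_self (by norm_num) m
    have hA : (auxKap (Kset lam k) m : ℝ) ≤
          auxKap (Kset lam k) (2 ^ J) + ⌊(2 : ℝ) ^ J * L⌋₊ := by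
        exact_mod_cast step J hJ _ hmJ2.le
    have hB : (auxKap (Kset lam k) m : ℝ) ≤ auxKap (Kset lam k) (2 ^ J) + (m - 2 ^ J) := by
      have := auxKap_add (Kset lam k) (Finset.Ico (2 ^ J) m) (2 ^ J) m
        (fun i hi1 hi2 _ => Finset.mem_Ico.2 ⟨hi1, hi2⟩)
      rw [Nat.card_Ico] at this
      have h3 : auxKap (Kset lam k) m + 2 ^ J ≤ auxKap (Kset lam k) (2 ^ J) + m := by omega
      have h4 : (auxKap (Kset lam k) m : ℝ) + 2 ^ J ≤ auxKap (Kset lam k) (2 ^ J) + m := by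
        exact_mod_cast h3
      linarith
    have hp := hpow J hJ
    have hf := hfl J
    have hmJr : (2 : ℝ) ^ J ≤ m := by exact_mod_cast hmJ
    set D : ℝ := (2 : ℝ) ^ J with hD
    have hA' : (auxKap (Kset lam k) m : ℝ) ≤ (2 ^ J0 : ℕ) + 2 * (D * L) := by linarith
    have hB' : (auxKap (Kset lam k) m : ℝ) ≤ (2 ^ J0 : ℕ) + D * L + (m - D) := by linarith
    have hDL : D * L * (2 - β) = D * β := by rw [mul_assoc, hLβ]
    -- convex combination with weights `1 - β` and `β`
    nlinarith

lemma aux_finite (lam : ℝ) (h0 : 0 ≤ lam) (h1 : lam ≤ 1) (k : ℕ) (hk : 0 < k)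
    (α : ℝ) (hα0 : 0 < α) (hα1 : α < 1) (h : α < (1 - lam) / (1 + lam)) :
    HasFiniteEnergy1 α (auxMu (Kset lam k)) := by
  have hlam : 2 * lam / (1 + lam) < 1 - α := by
    have e : 2 * lam / (1 + lam) = 1 - (1 - lam) / (1 + lam) := by field_simp; ring
    linarith
  obtain ⟨β, hβ, hβ1⟩ := exists_between hlam
  obtain ⟨C, hC⟩ := auxKap_bound lam β h0 h1 k hk hβ (by linarith)
  set K := Kset lam k with hK
  set f : ℕ → ℝ := fun n => ‖muHat1 (auxMu K) n‖ ^ 2 / (1 + (n : ℝ)) ^ (1 - α) with hf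
  have hf0 : ∀ n, 0 ≤ f n := fun n => by simp only [hf]; positivity
  suffices hs : Summable f by
    unfold HasFiniteEnergy1
    refine ((summable_nat_add_iff 1).2 hs).congr fun n => ?_
    simp only [hf]; push_cast; rfl
  set q : ℝ := (2 : ℝ) ^ (β - (1 - α)) with hq
  have hq0 : 0 < q := by positivity
  have hq1 : q < 1 := Real.rpow_lt_one_of_one_lt_of_neg (by norm_num) (by linarith)
  set r : ℕ → ℝ := fun j => (2 : ℝ) ^ ((C : ℝ) + β) * q ^ j with hr
  have hrs : Summable r := (summable_geometric_of_lt_one hq0.le hq1).mul_left _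
  have hr0 : ∀ j, 0 ≤ r j := fun j => by simp only [hr]; positivity
  have hblock : ∀ m : ℕ, ∑ n ∈ Finset.Ico (2 ^ m) (2 ^ (m + 1)), f n ≤ r m := by
    intro m
    have hp : (0 : ℝ) < ((2 : ℝ) ^ m) ^ (1 - α) := by positivity
    calc ∑ n ∈ Finset.Ico (2 ^ m) (2 ^ (m + 1)), f n
        ≤ ∑ n ∈ Finset.Ico (2 ^ m) (2 ^ (m + 1)),
            ‖muHat1 (auxMu K) ((n : ℕ) : ℤ)‖ ^ 2 / ((2 : ℝ) ^ m) ^ (1 - α) := by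
          refine Finset.sum_le_sum fun n hn => ?_
          have hn : (2 : ℝ) ^ m ≤ n := by exact_mod_cast (Finset.mem_Ico.1 hn).1
          simp only [hf]
          refine div_le_div_of_nonneg_left (by positivity) hp ?_
          exact Real.rpow_le_rpow (by positivity) (by linarith) (by linarith)
      _ = (∑ n ∈ Finset.Ico (2 ^ m) (2 ^ (m + 1)), ‖muHat1 (auxMu K) ((n : ℕ) : ℤ)‖ ^ 2) /
            ((2 : ℝ) ^ m) ^ (1 - α) := by rw [Finset.sum_div]
      _ ≤ 2 ^ auxKap K (m + 1) / ((2 : ℝ) ^ m) ^ (1 - α) := by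
          refine div_le_div_of_nonneg_right ?_ hp.le
          refine le_trans ?_ (auxMu_sum_le K (m + 1))
          refine Finset.sum_le_sum_of_subset_of_nonneg ?_ fun _ _ _ => by positivity
          intro n hn
          exact Finset.mem_range.2 (Finset.mem_Ico.1 hn).2
      _ ≤ 2 ^ ((C : ℝ) + β * (m + 1 : ℕ)) / ((2 : ℝ) ^ m) ^ (1 - α) := by
          refine div_le_div_of_nonneg_right ?_ hp.le
          rw [← Real.rpow_natCast]
          exact Real.rpow_le_rpow_of_exponent_le (by norm_num) (hC (m + 1))
      _ = r m := by
          simp only [hr, hq]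
          rw [← Real.rpow_natCast, ← Real.rpow_natCast, ← Real.rpow_mul (by norm_num),
            ← Real.rpow_mul (by norm_num), ← Real.rpow_sub (by norm_num),
            ← Real.rpow_add (by norm_num)]
          congr 1
          push_cast
          ring
  have hpart : ∀ m : ℕ, ∑ n ∈ Finset.range (2 ^ m), f n ≤ f 0 + ∑ j ∈ Finset.range m, r j := by
    intro m
    induction m with
    | zero => simp
    | succ m ih =>
      rw [← Finset.sum_range_add_sum_Ico f
        (Nat.pow_le_pow_right (by norm_num : 0 < 2) (Nat.le_succ m)), Finset.sum_range_succ]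
      linarith [hblock m]
  refine summable_of_sum_range_le (c := f 0 + ∑' j, r j) hf0 fun N => ?_
  calc ∑ n ∈ Finset.range N, f n ≤ ∑ n ∈ Finset.range (2 ^ N), f n :=
        Finset.sum_le_sum_of_subset_of_nonneg
          (Finset.range_mono Nat.lt_two_pow_self.le) fun _ _ _ => hf0 _
    _ ≤ f 0 + ∑ j ∈ Finset.range N, r j := hpart N
    _ ≤ _ := by gcongr; exact hrs.sum_le_tsum _ fun j _ => hr0 j

/-- Lemma 3.4(2): for every `λ ∈ [0,1]`, positive integer
`k`, and `α ∈ (0,1)`, one has `C_α(S_λ^k) = 0` iff `α ≥ (1-λ)/(1+λ)`. -/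
theorem stmt15 (lam : ℝ) (h0 : 0 ≤ lam) (h1 : lam ≤ 1) (k : ℕ) (hk : 0 < k)
    (α : ℝ) (hα0 : 0 < α) (hα1 : α < 1) :
    CapacityZero1 α (Sset lam k) ↔ (1 - lam) / (1 + lam) ≤ α := by
  constructor
  · intro hcap
    by_contra hlt
    push Not at hlt
    refine hcap (auxMu (Kset lam k)) inferInstance ⟨range (auxPhi (Kset lam k)), ?_,
      isCompact_range (auxPhi_continuous _), auxMu_supp _⟩
      (aux_finite lam h0 h1 k hk α hα0 hα1 hlt)
    rintro _ ⟨b, rfl⟩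
    exact auxPhi_mem lam k b
  · exact aux_zero lam h0 h1 k α hα0 hα1

end
end
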